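/- arXiv:1110.2841 — 4 statements merged into one kernel-verified Lean document; each statement's English description precedes it below -/
import Mathlib

section
/- Let G be a finite simple graph and x a vertex of G. Then pd(G) ≤ max{ pd(G − st x) + deg x, pd(G − x) + 1 }. -/
open CategoryTheory
open scoped ENNReal

noncomputable def projDim (R : Type) [CommRing R] (M : ModuleCat R) : ℕ∞ :=
  sSup {n : ℕ∞ | ∃ (i : ℕ) (N : ModuleCat R), n = i ∧
    Nontrivial (((Ext R (ModuleCat R) i).obj (Opposite.op M)).obj N)}

noncomputable def edgeIdeal (K : Type) [Field K] {V : Type} (G : SimpleGraph V) :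
    Ideal (MvPolynomial V K) :=
  Ideal.span {m | ∃ u v, G.Adj u v ∧ m = MvPolynomial.X u * MvPolynomial.X v}

noncomputable def graphPd (K : Type) [Field K] {V : Type} (G : SimpleGraph V) : ℕ∞ :=
  projDim (MvPolynomial V K)
    (ModuleCat.of (MvPolynomial V K) (MvPolynomial V K ⧸ edgeIdeal K G))

lemma subsingleton_Ext_iff {R C : Type*} [CommRing R] [Category* C] [Abelian C] [Linear R C]
    [EnoughProjectives C] [HasExt C] (X Y : C) (n : ℕ) :
    Subsingleton (((Ext R C (n + 1)).obj (Opposite.op X)).obj Y) ↔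
      ∀ e : Abelian.Ext X Y (n + 1), e = 0 := by
  let P := projectiveResolution X
  rw [← ModuleCat.isZero_iff_subsingleton, (P.isoExt (R := R) (n + 1) Y).isZero_iff,
    ← HomologicalComplex.exactAt_iff_isZero_homology,
    HomologicalComplex.exactAt_iff' _ n (n + 1) (n + 2) (by simp) (by simp),
    ShortComplex.moduleCat_exact_iff]
  constructor
  · intro h e
    obtain ⟨f, hf, rfl⟩ := P.extMk_surjective e (n + 2) rfl
    rw [P.extMk_eq_zero_iff _ _ _ _ n rfl]
    exact h f hf
  · intro h f hf
    exact (P.extMk_eq_zero_iff f (n + 2) rfl hf n rfl).1 (h _)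

lemma projDim_le_iff {R : Type} [CommRing R] (M : ModuleCat R) (n : ℕ) :
    projDim R M ≤ n ↔ HasProjectiveDimensionLT M (n + 1) := by
  rw [hasProjectiveDimensionLT_iff, projDim, sSup_le_iff]
  constructor
  · intro h i hi N
    obtain ⟨i, rfl⟩ := Nat.exists_eq_succ_of_ne_zero (by omega : i ≠ 0)
    refine (subsingleton_Ext_iff (R := R) M N i).1 ?_
    by_contra hN
    have := h _ ⟨i + 1, N, rfl, not_subsingleton_iff_nontrivial.1 hN⟩
    have : i + 1 ≤ n := by exact_mod_cast this
    omega
  · rintro h _ ⟨i, N, rfl, hN⟩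
    by_contra hi
    have hi : n + 1 ≤ i := by
      rw [not_le] at hi
      exact_mod_cast hi
    obtain ⟨i, rfl⟩ := Nat.exists_eq_succ_of_ne_zero (by omega : i ≠ 0)
    exact not_subsingleton_iff_nontrivial.2 hN
      ((subsingleton_Ext_iff (R := R) M N i).2 (fun e => h _ hi e))

lemma hasProjectiveDimensionLT_extendScalars {R S : Type} [CommRing R] [CommRing S]
    {f : R →+* S} (hf : f.Flat) (n : ℕ) (M : ModuleCat.{0} R)
    (hM : HasProjectiveDimensionLT M (n + 1)) :
    HasProjectiveDimensionLT ((ModuleCat.extendScalars.{0, 0, 0} f).obj M) (n + 1) := by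
  have := ModuleCat.preservesFiniteLimits_extendScalars_of_flat hf
  let adj := ModuleCat.extendRestrictScalarsAdj.{0, 0, 0} f
  have : (ModuleCat.extendScalars.{0, 0, 0} f).IsLeftAdjoint := adj.isLeftAdjoint
  have : (ModuleCat.extendScalars.{0, 0, 0} f).Additive :=
    Functor.additive_of_preserves_binary_products _
  induction n generalizing M with
  | zero =>
    have := (projective_iff_hasProjectiveDimensionLT_one (X := M)).2 hM
    exact projective_iff_hasProjectiveDimensionLT_one.1 (adj.map_projective M this)
  | succ n ih =>
    have hS := M.shortExact_projectiveShortComplex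
    have hp : Projective M.projectiveShortComplex.X₂ := inferInstance
    exact ((hS.map_of_exact (ModuleCat.extendScalars.{0, 0, 0} f)).hasProjectiveDimensionLT_X₃_iff n (adj.map_projective _ hp)).2
      (ih _ ((hS.hasProjectiveDimensionLT_X₃_iff n hp).1 hM))

lemma hasProjectiveDimensionLT_quotient_map {R S : Type} [CommRing R] [CommRing S]
    {f : R →+* S} (hf : f.Flat) (n : ℕ) (I : Ideal R)
    (hI : HasProjectiveDimensionLT (ModuleCat.of R (R ⧸ I)) (n + 1)) :
    HasProjectiveDimensionLT (ModuleCat.of S (S ⧸ I.map f)) (n + 1) := by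
  algebraize [f]
  have := hasProjectiveDimensionLT_extendScalars hf n _ hI
  let e : TensorProduct R S (R ⧸ I) ≃ₗ[S] S ⧸ I.map f :=
    (Algebra.TensorProduct.quotIdealMapEquivTensorQuot S I).symm.toLinearEquiv
  let i : (ModuleCat.extendScalars.{0, 0, 0} f).obj (ModuleCat.of R (R ⧸ I)) ≅
      ModuleCat.of S (S ⧸ I.map f) := e.toModuleIso
  exact hasProjectiveDimensionLT_of_iso i _

/-- The sequence `0 → R ⧸ (I : y) → R ⧸ I → R ⧸ (I + (y)) → 0`. -/
lemma exists_shortExact_colon {R : Type} [CommRing R] {I J : Ideal R} {y : R}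
    (hJ : ∀ f, f ∈ J ↔ y * f ∈ I) :
    ∃ S : ShortComplex (ModuleCat R), S.ShortExact ∧ S.X₁ = ModuleCat.of R (R ⧸ J) ∧
      S.X₂ = ModuleCat.of R (R ⧸ I) ∧ S.X₃ = ModuleCat.of R (R ⧸ I ⊔ Ideal.span {y}) := by
  let a : (R ⧸ J) →ₗ[R] R ⧸ I :=
    Submodule.mapQ J I (LinearMap.mulLeft R y) (fun f hf => (hJ f).1 hf)
  let b : (R ⧸ I) →ₗ[R] R ⧸ I ⊔ Ideal.span {y} :=
    Submodule.mapQ I (I ⊔ Ideal.span {y}) LinearMap.id (fun f hf => Ideal.mem_sup_left hf)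
  have ha (f : R) : a (Ideal.Quotient.mk J f) = Ideal.Quotient.mk I (y * f) := rfl
  have hb (f : R) : b (Ideal.Quotient.mk I f) = Ideal.Quotient.mk _ f := rfl
  have hab : Function.Exact a b := by
    intro f
    obtain ⟨f, rfl⟩ := Ideal.Quotient.mk_surjective f
    rw [hb, Ideal.Quotient.eq_zero_iff_mem, Submodule.mem_sup]
    constructor
    · rintro ⟨g, hg, z, hz, rfl⟩
      obtain ⟨w, rfl⟩ := Ideal.mem_span_singleton'.1 hz
      refine ⟨Ideal.Quotient.mk J w, ?_⟩
      rw [ha, Ideal.Quotient.eq]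
      convert I.neg_mem hg using 1
      ring
    · rintro ⟨w, hw⟩
      obtain ⟨w, rfl⟩ := Ideal.Quotient.mk_surjective w
      rw [ha, Ideal.Quotient.eq] at hw
      exact ⟨f - y * w, by convert I.neg_mem hw using 1; ring, y * w,
        Ideal.mem_span_singleton.2 (dvd_mul_right _ _), by ring⟩
  have ha_inj : Function.Injective a := by
    rw [injective_iff_map_eq_zero]
    intro f hf
    obtain ⟨f, rfl⟩ := Ideal.Quotient.mk_surjective f
    rw [ha, Ideal.Quotient.eq_zero_iff_mem] at hf
    exact Ideal.Quotient.eq_zero_iff_mem.2 ((hJ f).2 hf)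
  have hb_surj : Function.Surjective b := by
    intro f
    obtain ⟨f, rfl⟩ := Ideal.Quotient.mk_surjective f
    exact ⟨_, hb f⟩
  refine ⟨ShortComplex.mk (ModuleCat.ofHom a) (ModuleCat.ofHom b)
    (by ext1; exact LinearMap.ext hab.apply_apply_eq_zero), ?_, rfl, rfl, rfl⟩
  exact
    { exact := (ShortComplex.ShortExact.moduleCat_exact_iff_function_exact _).2 hab
      mono_f := (ModuleCat.mono_iff_injective _).2 ha_inj
      epi_g := (ModuleCat.epi_iff_surjective _).2 hb_surj }

lemma hasProjectiveDimensionLT_quotient_of_colon {R : Type} [CommRing R] {I J : Ideal R} {y : R}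
    (hJ : ∀ f, f ∈ J ↔ y * f ∈ I) (n : ℕ)
    (h₁ : HasProjectiveDimensionLT (ModuleCat.of R (R ⧸ J)) n)
    (h₃ : HasProjectiveDimensionLT (ModuleCat.of R (R ⧸ I ⊔ Ideal.span {y})) n) :
    HasProjectiveDimensionLT (ModuleCat.of R (R ⧸ I)) n := by
  obtain ⟨S, hS, e₁, e₂, e₃⟩ := exists_shortExact_colon hJ
  rw [← e₁] at h₁
  rw [← e₃] at h₃
  exact e₂ ▸ hS.hasProjectiveDimensionLT_X₂ n h₁ h₃

lemma hasProjectiveDimensionLT_quotient_sup_span {R : Type} [CommRing R] {I : Ideal R} {y : R}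
    (hI : ∀ f, f ∈ I ↔ y * f ∈ I) (n : ℕ)
    (h : HasProjectiveDimensionLT (ModuleCat.of R (R ⧸ I)) n) :
    HasProjectiveDimensionLT (ModuleCat.of R (R ⧸ I ⊔ Ideal.span {y})) (n + 1) := by
  obtain ⟨S, hS, e₁, e₂, e₃⟩ := exists_shortExact_colon hI
  exact e₃ ▸ hS.hasProjectiveDimensionLT_X₃ n (e₁ ▸ h)
    (e₂ ▸ hasProjectiveDimensionLT_of_ge _ n _ n.le_succ)

namespace MvPolynomial

/-- The ideal generated by the monomials with exponents in `A`. -/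
noncomputable def monomialIdeal (K : Type) [Field K] {V : Type} (A : Set (V →₀ ℕ)) :
    Ideal (MvPolynomial V K) :=
  Ideal.span ((fun s => monomial s 1) '' A)

variable {K : Type} [Field K] {V : Type}

lemma flat_rename_subtype (W : Set V) :
    (rename (R := K) ((↑) : W → V)).toRingHom.Flat := by
  classical
  let e := Equiv.Set.sumCompl W
  have hC : (C : MvPolynomial W K →+* MvPolynomial (Wᶜ : Set V) (MvPolynomial W K)).Flat :=
    RingHom.flat_algebraMap_iff.2 inferInstance
  let φ : MvPolynomial (Wᶜ : Set V) (MvPolynomial W K) ≃ₐ[K] MvPolynomial V K :=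
    (sumAlgEquiv K (Wᶜ : Set V) W).symm.trans (renameEquiv K ((Equiv.sumComm _ _).trans e))
  have h := hC.comp (RingHom.Flat.of_bijective (f := φ.toAlgHom.toRingHom) φ.bijective)
  convert h using 1
  ext w
  · simp [φ]
  · simp [φ, e]

lemma X_mul_mem_monomialIdeal {A B : Set (V →₀ ℕ)} {y : V} {f : MvPolynomial V K}
    (hAB : ∀ a ∈ A, ∀ s : V →₀ ℕ, a ≤ Finsupp.single y 1 + s → ∃ b ∈ B, b ≤ s)
    (hf : X y * f ∈ monomialIdeal K A) : f ∈ monomialIdeal K B := by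
  rw [monomialIdeal, mem_ideal_span_monomial_image] at hf ⊢
  intro s hs
  obtain ⟨a, ha, has⟩ := hf (Finsupp.single y 1 + s) (by
    rw [mem_support_iff, coeff_X_mul]
    exact mem_support_iff.1 hs)
  exact hAB a ha s has

lemma monomialIdeal_insert (A : Set (V →₀ ℕ)) (y : V) :
    monomialIdeal K (insert (Finsupp.single y 1) A) = monomialIdeal K A ⊔ Ideal.span {X y} := by
  rw [monomialIdeal, Set.image_insert_eq, Ideal.span_insert, sup_comm]
  rfl

lemma hasProjectiveDimensionLT_quotient_insert {A : Set (V →₀ ℕ)} {y : V} (hA : ∀ a ∈ A, a y = 0)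
    (n : ℕ)
    (h : HasProjectiveDimensionLT (ModuleCat.of (MvPolynomial V K) (MvPolynomial V K ⧸ monomialIdeal K A)) n) :
    HasProjectiveDimensionLT (ModuleCat.of (MvPolynomial V K) (MvPolynomial V K ⧸
      monomialIdeal K (insert (Finsupp.single y 1) A))) (n + 1) := by
  rw [monomialIdeal_insert]
  refine hasProjectiveDimensionLT_quotient_sup_span (fun f => ⟨Ideal.mul_mem_left _ _,
    X_mul_mem_monomialIdeal fun a ha s has => ⟨a, ha, fun v => ?_⟩⟩) n h
  by_cases hv : y = v
  · simp [← hv, hA a ha]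
  · simpa [Finsupp.single_apply, hv] using has v

lemma hasProjectiveDimensionLT_quotient_union {A : Set (V →₀ ℕ)} (T : Finset V)
    (hA : ∀ a ∈ A, ∀ y ∈ T, a y = 0) (n : ℕ)
    (h : HasProjectiveDimensionLT (ModuleCat.of (MvPolynomial V K) (MvPolynomial V K ⧸ monomialIdeal K A)) n) :
    HasProjectiveDimensionLT (ModuleCat.of (MvPolynomial V K) (MvPolynomial V K ⧸
      monomialIdeal K ((fun y => Finsupp.single y 1) '' (T : Set V) ∪ A))) (n + T.card) := by
  classical
  induction T using Finset.induction_on with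
  | empty => rwa [Finset.coe_empty, Set.image_empty, Set.empty_union]
  | insert y T hy ih =>
    rw [Finset.coe_insert, Set.image_insert_eq, Set.insert_union, Finset.card_insert_of_notMem hy,
      ← add_assoc]
    refine hasProjectiveDimensionLT_quotient_insert ?_ _
      (ih fun a ha z hz => hA a ha z (Finset.mem_insert_of_mem hz))
    rintro _ (⟨z, hz, rfl⟩ | ha)
    · exact Finsupp.single_eq_of_ne (by rintro rfl; exact hy hz)
    · exact hA _ ha y (Finset.mem_insert_self _ _)

end MvPolynomial

open MvPolynomial

section EdgeIdeal

variable {V : Type} (G : SimpleGraph V)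

/-- The exponents of the generators of the edge ideal of `G[W]`, as exponents on `V`. -/
def edgeExponents (W : Set V) : Set (V →₀ ℕ) :=
  {a | ∃ u ∈ W, ∃ v ∈ W, G.Adj u v ∧ a = Finsupp.single u 1 + Finsupp.single v 1}

variable {G} in
lemma edgeExponents_apply_eq_zero {W : Set V} {a : V →₀ ℕ} (ha : a ∈ edgeExponents G W) {y : V}
    (hy : y ∉ W) : a y = 0 := by
  obtain ⟨u, hu, v, hv, -, rfl⟩ := ha
  have hu : y ≠ u := fun h => hy (h ▸ hu)
  have hv : y ≠ v := fun h => hy (h ▸ hv)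
  simp [Finsupp.single_eq_of_ne hu, Finsupp.single_eq_of_ne hv]

variable (K : Type) [Field K]

lemma monomial_single_add_single (u v : V) :
    (monomial (Finsupp.single u 1 + Finsupp.single v 1) 1 : MvPolynomial V K) = X u * X v := by
  simp [X, monomial_mul]

lemma edgeIdeal_eq_monomialIdeal :
    edgeIdeal K G = monomialIdeal K (edgeExponents G Set.univ) := by
  rw [edgeIdeal, monomialIdeal]
  congr 1
  ext m
  constructor
  · rintro ⟨u, v, h, rfl⟩
    exact ⟨_, ⟨u, trivial, v, trivial, h, rfl⟩, monomial_single_add_single K u v⟩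
  · rintro ⟨_, ⟨u, -, v, -, h, rfl⟩, rfl⟩
    exact ⟨u, v, h, monomial_single_add_single K u v⟩

lemma map_edgeIdeal_induce (W : Set V) :
    (edgeIdeal K (G.induce W)).map (rename (R := K) ((↑) : W → V)).toRingHom =
      monomialIdeal K (edgeExponents G W) := by
  rw [edgeIdeal, monomialIdeal, Ideal.map_span]
  congr 1
  ext m
  constructor
  · rintro ⟨_, ⟨u, v, h, rfl⟩, rfl⟩
    exact ⟨_, ⟨u, u.2, v, v.2, h, rfl⟩, by simp [monomial_single_add_single]⟩
  · rintro ⟨_, ⟨u, hu, v, hv, h, rfl⟩, rfl⟩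
    exact ⟨_, ⟨⟨u, hu⟩, ⟨v, hv⟩, h, rfl⟩, by simp [monomial_single_add_single]⟩

lemma hasProjectiveDimensionLT_of_graphPd_induce_le {W : Set V} {n : ℕ}
    (h : graphPd K (G.induce W) ≤ n) (T : Finset V) (hT : Disjoint (T : Set V) W) :
    HasProjectiveDimensionLT (ModuleCat.of (MvPolynomial V K) (MvPolynomial V K ⧸
      monomialIdeal K ((fun y => Finsupp.single y 1) '' (T : Set V) ∪ edgeExponents G W)))
      (n + 1 + T.card) := by
  refine hasProjectiveDimensionLT_quotient_union T (fun a ha y hy =>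
    edgeExponents_apply_eq_zero ha (Set.disjoint_left.1 hT hy)) _ ?_
  rw [← map_edgeIdeal_induce]
  exact hasProjectiveDimensionLT_quotient_map (flat_rename_subtype W) n _ ((projDim_le_iff _ _).1 h)

variable {G}

lemma mem_colon_edgeIdeal_iff {x : V} (f : MvPolynomial V K) :
    f ∈ monomialIdeal K ((fun y => Finsupp.single y 1) '' G.neighborSet x ∪
      edgeExponents G (G.neighborSet x ∪ {x})ᶜ) ↔ X x * f ∈ edgeIdeal K G := by
  constructor
  · intro hf
    suffices h : monomialIdeal K ((fun y => Finsupp.single y 1) '' G.neighborSet x ∪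
        edgeExponents G (G.neighborSet x ∪ {x})ᶜ) ≤
        Submodule.comap (LinearMap.mulLeft (MvPolynomial V K) (X x)) (edgeIdeal K G) from h hf
    refine Ideal.span_le.2 ?_
    rintro _ ⟨_, ⟨y, hy, rfl⟩ | ⟨u, -, v, -, h, rfl⟩, rfl⟩
    · exact Ideal.subset_span ⟨x, y, hy, rfl⟩
    · exact (edgeIdeal K G).mul_mem_left _
        (Ideal.subset_span ⟨u, v, h, monomial_single_add_single K u v⟩)
  · rw [edgeIdeal_eq_monomialIdeal]
    refine X_mul_mem_monomialIdeal ?_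
    rintro _ ⟨u, -, v, -, h, rfl⟩ s hs
    have key (z : V) (hz : z ∈ G.neighborSet x) (hzs : z = u ∨ z = v) :
        ∃ b ∈ (fun y => Finsupp.single y 1) '' G.neighborSet x ∪
          edgeExponents G (G.neighborSet x ∪ {x})ᶜ, b ≤ s := by
      have hxz : x ≠ z := G.ne_of_adj hz
      refine ⟨_, Or.inl ⟨z, hz, rfl⟩, Finsupp.single_le_iff.2 ?_⟩
      have := hs z
      simp only [Finsupp.add_apply, Finsupp.single_eq_of_ne hxz.symm] at this
      rcases hzs with rfl | rfl <;> simp at this <;> omega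
    by_cases hu : u ∈ G.neighborSet x
    · exact key u hu (Or.inl rfl)
    by_cases hv : v ∈ G.neighborSet x
    · exact key v hv (Or.inr rfl)
    have hux : u ≠ x := by rintro rfl; exact hv h
    have hvx : v ≠ x := by rintro rfl; exact hu h.symm
    refine ⟨_, Or.inr ⟨u, by simp_all, v, by simp_all, h, rfl⟩, fun z => ?_⟩
    by_cases hz : z = x
    · simp [hz, Finsupp.single_eq_of_ne hux.symm, Finsupp.single_eq_of_ne hvx.symm]
    · simpa [Finsupp.single_eq_of_ne hz] using hs z

lemma edgeIdeal_sup_span_X (x : V) :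
    edgeIdeal K G ⊔ Ideal.span {X x} =
      monomialIdeal K ((fun y => Finsupp.single y 1) '' {x} ∪ edgeExponents G {x}ᶜ) := by
  rw [Set.image_singleton, Set.singleton_union, monomialIdeal_insert]
  refine le_antisymm (sup_le (Ideal.span_le.2 ?_) le_sup_right) (sup_le (Ideal.span_le.2 ?_)
    le_sup_right)
  · rintro _ ⟨u, v, h, rfl⟩
    have hx : X x ∈ monomialIdeal K (edgeExponents G {x}ᶜ) ⊔ Ideal.span {X x} :=
      Ideal.mem_sup_right (Ideal.mem_span_singleton_self _)
    by_cases hu : u = x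
    · exact Ideal.mul_mem_right _ _ (hu ▸ hx)
    by_cases hv : v = x
    · exact Ideal.mul_mem_left _ _ (hv ▸ hx)
    exact Ideal.mem_sup_left (Ideal.subset_span
      ⟨_, ⟨u, hu, v, hv, h, rfl⟩, monomial_single_add_single K u v⟩)
  · rintro _ ⟨_, ⟨u, -, v, -, h, rfl⟩, rfl⟩
    exact Ideal.mem_sup_left (Ideal.subset_span ⟨u, v, h, monomial_single_add_single K u v⟩)

end EdgeIdeal

theorem stmt0 (K : Type) [Field K] {V : Type} [Fintype V] (G : SimpleGraph V) (x : V) :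
    graphPd K G ≤
      max (graphPd K (G.induce ((G.neighborSet x ∪ {x})ᶜ)) + ((G.neighborSet x).ncard : ℕ∞))
        (graphPd K (G.induce ({x}ᶜ : Set V)) + 1) := by
  classical
  generalize ha : graphPd K (G.induce ((G.neighborSet x ∪ {x})ᶜ)) = a
  generalize hb : graphPd K (G.induce ({x}ᶜ : Set V)) = b
  induction a with
  | top => simp
  | coe a =>
  induction b with
  | top => simp
  | coe b =>
  set T := (G.neighborSet x).toFinset with hT
  have hTc : (T : Set V) = G.neighborSet x := by simp [hT]
  have h₁ := hasProjectiveDimensionLT_of_graphPd_induce_le G K ha.le T (by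
    rw [hTc]
    exact disjoint_compl_right.mono_left Set.subset_union_left)
  have h₃ := hasProjectiveDimensionLT_of_graphPd_induce_le G K hb.le {x} (by simp)
  rw [hTc] at h₁
  rw [Finset.coe_singleton, ← edgeIdeal_sup_span_X, Finset.card_singleton] at h₃
  have h : graphPd K G ≤ (max (a + T.card) (b + 1) : ℕ) :=
    (projDim_le_iff _ _).2 <|
      hasProjectiveDimensionLT_quotient_of_colon (mem_colon_edgeIdeal_iff K (x := x)) _
        (hasProjectiveDimensionLT_of_ge _ (a + 1 + T.card) _ (by omega))
        (hasProjectiveDimensionLT_of_ge _ (b + 1 + 1) _ (by omega))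
  rw [← hTc, Set.ncard_coe_finset]
  exact_mod_cast h
end

section
/- Let m ≥ 1 and let G be a finite simple graph on n vertices with at least one edge, containing no induced subgraph isomorphic to K_{1,m+1}. Let (x, y) be an ((m−1)/m)-max edge of G, with d = deg(x) ≥ deg(y) = e. Then pd(G) ≤ n(1 − 1/(d + ((m−1)/m)·e + 1)). -/
open CategoryTheory
open scoped ENNReal

/-- `(x, y)` is an `α`-max edge of `G`: it is an edge maximizing `deg x + α · deg y`. -/
def IsAlphaMaxEdge {V : Type} (G : SimpleGraph V) (α : ℝ) (x y : V) : Prop :=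
  G.Adj x y ∧ ∀ u v : V, G.Adj u v →
    ((G.neighborSet u).ncard : ℝ) + α * (G.neighborSet v).ncard ≤
      ((G.neighborSet x).ncard : ℝ) + α * (G.neighborSet y).ncard

theorem subsingleton_Ext_of_hasProjectiveDimensionLT {R : Type} [CommRing R] {M N : ModuleCat.{0} R}
    {i c : ℕ} (h : HasProjectiveDimensionLT M c) (hci : c ≤ i) (hi : 1 ≤ i) :
    Subsingleton (((Ext R (ModuleCat R) i).obj (Opposite.op M)).obj N) := by
  let := HasExt.standard (ModuleCat.{0} R)
  obtain ⟨j, rfl⟩ : ∃ j, i = j + 1 := ⟨i - 1, by omega⟩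
  let P := projectiveResolution M
  rw [← ModuleCat.isZero_iff_subsingleton]
  refine Limits.IsZero.of_iso ?_ (P.isoExt (j + 1) N)
  rw [← HomologicalComplex.exactAt_iff_isZero_homology,
    HomologicalComplex.exactAt_iff' _ j (j + 1) (j + 2) (by simp) (by simp),
    ShortComplex.moduleCat_exact_iff]
  intro f hf
  have hf' : P.complex.d (j + 2) (j + 1) ≫ f = 0 := hf
  obtain ⟨g, hg⟩ := (P.extMk_eq_zero_iff f (j + 2) rfl hf' j rfl).1
    (Abelian.Ext.eq_zero_of_hasProjectiveDimensionLT _ c hci)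
  exact ⟨g, hg⟩

/-- If `I' = I : r` and `I'' = I + (r)`, then `0 → R/I' → R/I → R/I'' → 0` is exact. -/
theorem exists_shortExact_quotient {R : Type} [CommRing R] {I I' I'' : Ideal R} {r : R}
    (h : ∀ p, r * p ∈ I ↔ p ∈ I') (h' : I'' = I ⊔ Ideal.span {r}) :
    ∃ S : ShortComplex (ModuleCat.{0} R), S.ShortExact ∧ S.X₁ = ModuleCat.of R (R ⧸ I') ∧
      S.X₂ = ModuleCat.of R (R ⧸ I) ∧ S.X₃ = ModuleCat.of R (R ⧸ I'') := by
  let f : (R ⧸ I') →ₗ[R] (R ⧸ I) :=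
    Submodule.mapQ I' I (LinearMap.mulLeft R r) fun p hp => (h p).2 hp
  let g : (R ⧸ I) →ₗ[R] (R ⧸ I'') :=
    Submodule.mapQ I I'' LinearMap.id (h' ▸ le_sup_left)
  have hex : Function.Exact f g := by
    intro z
    obtain ⟨z, rfl⟩ := Submodule.Quotient.mk_surjective _ z
    constructor
    · intro hz
      have hz : z ∈ I'' := (Submodule.Quotient.mk_eq_zero _).1 hz
      rw [h', Submodule.mem_sup] at hz
      obtain ⟨a, ha, b, hb, rfl⟩ := hz
      obtain ⟨q, rfl⟩ := Ideal.mem_span_singleton'.1 hb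
      refine ⟨Submodule.Quotient.mk q, (Submodule.Quotient.eq I).2 ?_⟩
      have : r * q - (a + q * r) = -a := by ring
      simpa [this] using ha
    · rintro ⟨w, hw⟩
      obtain ⟨w, rfl⟩ := Submodule.Quotient.mk_surjective _ w
      rw [← hw]
      refine (Submodule.Quotient.mk_eq_zero I'').2 ?_
      rw [h']
      exact Ideal.mem_sup_right (Ideal.mul_mem_right _ _ (Ideal.mem_span_singleton_self r))
  have hf : Function.Injective f := by
    rw [injective_iff_map_eq_zero]
    intro z hz
    obtain ⟨z, rfl⟩ := Submodule.Quotient.mk_surjective _ z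
    exact (Submodule.Quotient.mk_eq_zero I').2
      ((h z).1 ((Submodule.Quotient.mk_eq_zero I).1 hz))
  have hg : Function.Surjective g := by
    intro z
    obtain ⟨z, rfl⟩ := Submodule.Quotient.mk_surjective _ z
    exact ⟨Submodule.Quotient.mk z, rfl⟩
  refine ⟨ShortComplex.mk (ModuleCat.ofHom f) (ModuleCat.ofHom g) ?_, ?_, rfl, rfl, rfl⟩
  · exact ModuleCat.hom_ext (LinearMap.ext fun z => (hex _).2 ⟨_, rfl⟩)
  · exact ModuleCat.shortComplex_shortExact _ hex hf hg

/-- The edge ideal of the subgraph induced on `W`, plus the variables indexed by `U`. -/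
noncomputable def inducedEdgeIdeal (K : Type) [Field K] {V : Type} (G : SimpleGraph V) (U W : Finset V) :
    Ideal (MvPolynomial V K) :=
  Ideal.span ((fun s => MvPolynomial.monomial s (1 : K)) ''
    {s | (∃ u ∈ U, s = Finsupp.single u 1) ∨
      ∃ u ∈ W, ∃ v ∈ W, G.Adj u v ∧ s = Finsupp.single u 1 + Finsupp.single v 1})

section

variable {K : Type} [Field K] {V : Type} {G : SimpleGraph V} {U W : Finset V}

theorem mem_inducedEdgeIdeal {p : MvPolynomial V K} :
    p ∈ inducedEdgeIdeal K G U W ↔ ∀ s ∈ p.support,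
      (∃ u ∈ U, s u ≠ 0) ∨ ∃ u ∈ W, ∃ v ∈ W, G.Adj u v ∧ s u ≠ 0 ∧ s v ≠ 0 := by
  classical
  rw [inducedEdgeIdeal, MvPolynomial.mem_ideal_span_monomial_image]
  refine forall₂_congr fun s _ => ⟨?_, ?_⟩
  · rintro ⟨t, ⟨u, hu, rfl⟩ | ⟨u, hu, v, hv, huv, rfl⟩, hts⟩
    · have := hts u
      simp only [Finsupp.single_eq_same] at this
      exact Or.inl ⟨u, hu, by omega⟩
    · have h1 := hts u
      have h2 := hts v
      simp only [Finsupp.add_apply, Finsupp.single_eq_same] at h1 h2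
      exact Or.inr ⟨u, hu, v, hv, huv, by omega, by omega⟩
  · rintro (⟨u, hu, hs⟩ | ⟨u, hu, v, hv, huv, h1, h2⟩)
    · refine ⟨_, Or.inl ⟨u, hu, rfl⟩, ?_⟩
      rw [Finsupp.single_le_iff]
      omega
    · refine ⟨_, Or.inr ⟨u, hu, v, hv, huv, rfl⟩, fun w => ?_⟩
      have := huv.ne
      simp only [Finsupp.add_apply, Finsupp.single_apply]
      split_ifs with h h' h'
      · exact absurd (h.trans h'.symm) this
      · subst h; omega
      · subst h'; omega
      · omega

theorem X_mem_inducedEdgeIdeal {u : V} (hu : u ∈ U) :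
    MvPolynomial.X u ∈ inducedEdgeIdeal K G U W :=
  Ideal.subset_span ⟨_, Or.inl ⟨u, hu, rfl⟩, rfl⟩

theorem X_mul_X_mem_inducedEdgeIdeal {u v : V} (hu : u ∈ W) (hv : v ∈ W) (h : G.Adj u v) :
    MvPolynomial.X u * MvPolynomial.X v ∈ inducedEdgeIdeal K G U W :=
  Ideal.subset_span ⟨_, Or.inr ⟨u, hu, v, hv, h, rfl⟩, by
    simp [MvPolynomial.X, MvPolynomial.monomial_mul]⟩

theorem inducedEdgeIdeal_le {I : Ideal (MvPolynomial V K)}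
    (hU : ∀ u ∈ U, MvPolynomial.X u ∈ I)
    (hW : ∀ u ∈ W, ∀ v ∈ W, G.Adj u v → MvPolynomial.X u * MvPolynomial.X v ∈ I) :
    inducedEdgeIdeal K G U W ≤ I := by
  refine Ideal.span_le.2 ?_
  rintro _ ⟨t, ⟨u, hu, rfl⟩ | ⟨u, hu, v, hv, huv, rfl⟩, rfl⟩
  · exact hU u hu
  · simpa [MvPolynomial.X, MvPolynomial.monomial_mul] using hW u hu v hv huv

theorem edgeIdeal_eq_inducedEdgeIdeal [Fintype V] :
    edgeIdeal K G = inducedEdgeIdeal K G ∅ Finset.univ := by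
  refine le_antisymm (Ideal.span_le.2 ?_) (inducedEdgeIdeal_le (by simp) fun u _ v _ h =>
    Ideal.subset_span ⟨u, v, h, rfl⟩)
  rintro _ ⟨u, v, h, rfl⟩
  exact X_mul_X_mem_inducedEdgeIdeal (Finset.mem_univ _) (Finset.mem_univ _) h

theorem inducedEdgeIdeal_congr {W' : Finset V}
    (h : ∀ u v, G.Adj u v → (u ∈ W ∧ v ∈ W ↔ u ∈ W' ∧ v ∈ W')) :
    inducedEdgeIdeal K G U W = inducedEdgeIdeal K G U W' := by
  refine le_antisymm (inducedEdgeIdeal_le (fun u => X_mem_inducedEdgeIdeal) ?_)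
    (inducedEdgeIdeal_le (fun u => X_mem_inducedEdgeIdeal) ?_)
  · intro u hu v hv huv
    have := (h u v huv).1 ⟨hu, hv⟩
    exact X_mul_X_mem_inducedEdgeIdeal this.1 this.2 huv
  · intro u hu v hv huv
    have := (h u v huv).2 ⟨hu, hv⟩
    exact X_mul_X_mem_inducedEdgeIdeal this.1 this.2 huv

open scoped Classical in
theorem inducedEdgeIdeal_insert (a : V) :
    inducedEdgeIdeal K G (insert a U) (W.erase a) =
      inducedEdgeIdeal K G U W ⊔ Ideal.span {MvPolynomial.X a} := by
  have ha : (MvPolynomial.X a : MvPolynomial V K) ∈ inducedEdgeIdeal K G (insert a U) (W.erase a) :=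
    X_mem_inducedEdgeIdeal (Finset.mem_insert_self _ _)
  refine le_antisymm (inducedEdgeIdeal_le ?_ ?_)
    (sup_le (inducedEdgeIdeal_le ?_ ?_) ((Ideal.span_singleton_le_iff_mem _).2 ha))
  · intro u hu
    rcases Finset.mem_insert.1 hu with rfl | hu
    · exact Ideal.mem_sup_right (Ideal.mem_span_singleton_self _)
    · exact Ideal.mem_sup_left (X_mem_inducedEdgeIdeal hu)
  · intro u hu v hv huv
    exact Ideal.mem_sup_left (X_mul_X_mem_inducedEdgeIdeal (Finset.mem_of_mem_erase hu)
      (Finset.mem_of_mem_erase hv) huv)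
  · intro u hu
    exact X_mem_inducedEdgeIdeal (Finset.mem_insert_of_mem hu)
  · intro u hu v hv huv
    by_cases h1 : u = a
    · subst h1; exact Ideal.mul_mem_right _ _ ha
    by_cases h2 : v = a
    · subst h2; exact Ideal.mul_mem_left _ _ ha
    exact X_mul_X_mem_inducedEdgeIdeal (Finset.mem_erase.2 ⟨h1, hu⟩)
      (Finset.mem_erase.2 ⟨h2, hv⟩) huv

open scoped Classical in
theorem X_mul_mem_inducedEdgeIdeal_iff {a : V} (haU : a ∉ U)
    (haW : ∀ v ∈ W, G.Adj a v → a ∈ W) (p : MvPolynomial V K) :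
    MvPolynomial.X a * p ∈ inducedEdgeIdeal K G U W ↔
      p ∈ inducedEdgeIdeal K G (U ∪ {v ∈ W | G.Adj a v})
        {v ∈ W | ¬ (v = a ∨ G.Adj a v)} := by
  rw [mem_inducedEdgeIdeal, mem_inducedEdgeIdeal, MvPolynomial.support_X_mul]
  simp only [Finset.mem_map, addLeftEmbedding_apply, forall_exists_index, and_imp,
    forall_apply_eq_imp_iff₂]
  refine forall₂_congr fun s _ => ?_
  have hs : ∀ u, u ≠ a → (Finsupp.single a 1 + s : V →₀ ℕ) u = s u := fun u hu => by
    simp [hu.symm]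
  have hs' : ∀ u, s u ≠ 0 → (Finsupp.single a 1 + s : V →₀ ℕ) u ≠ 0 := fun u hu => by
    simp only [Finsupp.add_apply]; omega
  constructor
  · rintro (⟨u, hu, h⟩ | ⟨u, hu, v, hv, huv, h1, h2⟩)
    · rw [hs u (by rintro rfl; exact haU hu)] at h
      exact Or.inl ⟨u, Finset.mem_union_left _ hu, h⟩
    · by_cases hua : u = a
      · subst hua
        rw [hs v huv.ne'] at h2
        exact Or.inl ⟨v, by simp [hv, huv], h2⟩
      by_cases hva : v = a
      · subst hva
        rw [hs u hua] at h1
        exact Or.inl ⟨u, by simp [hu, huv.symm], h1⟩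
      rw [hs u hua] at h1
      rw [hs v hva] at h2
      by_cases hau : G.Adj a u
      · exact Or.inl ⟨u, by simp [hu, hau], h1⟩
      by_cases hav : G.Adj a v
      · exact Or.inl ⟨v, by simp [hv, hav], h2⟩
      exact Or.inr ⟨u, by simp [*], v, by simp [*], huv, h1, h2⟩
  · rintro (⟨u, hu, h⟩ | ⟨u, hu, v, hv, huv, h1, h2⟩)
    · rcases Finset.mem_union.1 hu with hu | hu
      · exact Or.inl ⟨u, hu, hs' u h⟩
      · obtain ⟨hu, hau⟩ := Finset.mem_filter.1 hu
        exact Or.inr ⟨a, haW u hu hau, u, hu, hau, by simp, hs' u h⟩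
    · exact Or.inr ⟨u, (Finset.mem_filter.1 hu).1, v, (Finset.mem_filter.1 hv).1, huv,
        hs' u h1, hs' v h2⟩

/-- The quotient by `inducedEdgeIdeal K G U W` has projective dimension `< c`. -/
def InducedPdLT (K : Type) [Field K] {V : Type} (G : SimpleGraph V) (U W : Finset V) (c : ℕ) :
    Prop :=
  HasProjectiveDimensionLT (ModuleCat.of (MvPolynomial V K)
    (MvPolynomial V K ⧸ inducedEdgeIdeal K G U W)) c

theorem InducedPdLT.mono {c d : ℕ} (h : InducedPdLT K G U W c) (hcd : c ≤ d) :
    InducedPdLT K G U W d :=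
  have : HasProjectiveDimensionLT _ c := h
  hasProjectiveDimensionLT_of_ge _ c d hcd

open scoped Classical in
theorem InducedPdLT.of_vertex {a : V} {c : ℕ} (haU : a ∉ U) (haW : a ∈ W)
    (h₁ : InducedPdLT K G (U ∪ {v ∈ W | G.Adj a v}) {v ∈ W | ¬ (v = a ∨ G.Adj a v)} c)
    (h₃ : InducedPdLT K G (insert a U) (W.erase a) c) :
    InducedPdLT K G U W c := by
  obtain ⟨S, hS, e₁, e₂, e₃⟩ := exists_shortExact_quotient
    (X_mul_mem_inducedEdgeIdeal_iff (K := K) haU fun _ _ _ => haW)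
    (inducedEdgeIdeal_insert (K := K) (G := G) (U := U) (W := W) a)
  unfold InducedPdLT at *
  rw [← e₂]
  exact hS.hasProjectiveDimensionLT_X₂ c (e₁ ▸ h₁) (e₃ ▸ h₃)

open scoped Classical in
theorem inducedPdLT_empty (U : Finset V) : InducedPdLT K G U ∅ (U.card + 1) := by
  induction U using Finset.induction_on with
  | empty =>
    have h : inducedEdgeIdeal K G ∅ ∅ = ⊥ :=
      le_bot_iff.1 (inducedEdgeIdeal_le (by simp) (by simp))
    unfold InducedPdLT
    rw [h]
    have : Module.Projective (MvPolynomial V K)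
        (MvPolynomial V K ⧸ (⊥ : Ideal (MvPolynomial V K))) :=
      Module.Projective.of_equiv (Submodule.quotEquivOfEqBot _ rfl).symm
    have := (IsProjective.iff_projective (R := MvPolynomial V K)
        (MvPolynomial V K ⧸ (⊥ : Ideal (MvPolynomial V K)))).1 this
    exact projective_iff_hasProjectiveDimensionLT_one.1 this
  | insert a U ha ih =>
    obtain ⟨S, hS, e₁, e₂, e₃⟩ := exists_shortExact_quotient
      (I' := inducedEdgeIdeal K G U ∅) (I'' := inducedEdgeIdeal K G (insert a U) ∅)
      (fun p => by simpa using X_mul_mem_inducedEdgeIdeal_iff (G := G) (W := ∅) ha (by simp) p)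
      (by simpa using inducedEdgeIdeal_insert (K := K) (G := G) (U := U) (W := ∅) a)
    unfold InducedPdLT at *
    rw [← e₃, Finset.card_insert_of_notMem ha]
    have ih' := InducedPdLT.mono ih (Nat.le_succ _)
    unfold InducedPdLT at ih'
    exact hS.hasProjectiveDimensionLT_X₃ _ (e₁ ▸ ih) (e₂ ▸ ih')

open scoped Classical in
/-- If every independent subset of `A` has at most `m` elements, then some closed neighborhood
contains at least an `m`-th of `A`. -/
theorem exists_card_le_mul_card_filter_adj {A : Finset V} (hA : A.Nonempty) {m : ℕ}
    (hm : ∀ I ⊆ A, (∀ u ∈ I, ∀ v ∈ I, ¬ G.Adj u v) → I.card ≤ m) :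
    ∃ a ∈ A, A.card ≤ m * {v ∈ A | v = a ∨ G.Adj a v}.card := by
  obtain ⟨I, hI, hmax⟩ := Finset.exists_max_image
    {I ∈ A.powerset | ∀ u ∈ I, ∀ v ∈ I, ¬ G.Adj u v} Finset.card ⟨∅, by simp⟩
  simp only [Finset.mem_filter, Finset.mem_powerset, and_imp] at hI hmax
  obtain ⟨hIA, hind⟩ := hI
  have hcover : A ⊆ I.biUnion fun a => {v ∈ A | v = a ∨ G.Adj a v} := by
    intro v hv
    rw [Finset.mem_biUnion]
    by_cases hvI : v ∈ I
    · exact ⟨v, hvI, by simp [hv]⟩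
    by_contra! hcon
    have hna : ∀ u ∈ I, ¬ G.Adj u v := fun u hu huv => hcon u hu (by simp [hv, huv])
    have := hmax (insert v I) (Finset.insert_subset hv hIA) (by
      intro u hu w hw
      rcases Finset.mem_insert.1 hu with rfl | hu' <;> rcases Finset.mem_insert.1 hw with rfl | hw'
      · exact G.irrefl
      · exact fun h => hna w hw' h.symm
      · exact hna u hu'
      · exact hind u hu' w hw')
    rw [Finset.card_insert_of_notMem hvI] at this
    omega
  have hle := (Finset.card_le_card hcover).trans Finset.card_biUnion_le
  have hIne : I.Nonempty := by
    obtain ⟨v, hv⟩ := hA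
    obtain ⟨u, hu, -⟩ := Finset.mem_biUnion.1 (hcover hv)
    exact ⟨u, hu⟩
  obtain ⟨a, ha, hamax⟩ := Finset.exists_max_image I
    (fun a => {v ∈ A | v = a ∨ G.Adj a v}.card) hIne
  refine ⟨a, hIA ha, hle.trans ((Finset.sum_le_card_nsmul _ _ _ hamax).trans ?_)⟩
  rw [smul_eq_mul]
  exact Nat.mul_le_mul_right _ (hm I hIA hind)

theorem exists_iso_completeBipartiteGraph {m : ℕ} {x : V} {I : Finset V}
    (hx : ∀ v ∈ I, G.Adj x v) (hind : ∀ u ∈ I, ∀ v ∈ I, ¬ G.Adj u v) (hI : I.card = m + 1) :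
    ∃ s : Set V, Nonempty (G.induce s ≃g completeBipartiteGraph (Fin 1) (Fin (m + 1))) := by
  let e : Fin (m + 1) ≃ I := (I.equivFinOfCardEq hI).symm
  let f : Fin 1 ⊕ Fin (m + 1) → V := Sum.elim (fun _ => x) (fun i => e i)
  have hf : Function.Injective f := by
    refine Function.Injective.sumElim (Function.injective_of_subsingleton _)
      (Subtype.val_injective.comp e.injective) fun _ j => (hx _ (e j).2).ne
  refine ⟨Set.range f, ⟨(RelIso.symm ⟨Equiv.ofInjective f hf, ?_⟩)⟩⟩
  rintro (i | i) (j | j)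
  · simp [f]
  · simpa [f] using hx _ (e j).2
  · simpa [f] using (hx _ (e i).2).symm
  · simpa [f] using hind _ (e i).2 _ (e j).2

open scoped Classical in
theorem inducedPdLT_of_lt [Fintype V] {m : ℕ} (hm : 1 ≤ m)
    (hind : ∀ x : V, ∀ I : Finset V, (∀ v ∈ I, G.Adj x v) →
      (∀ u ∈ I, ∀ v ∈ I, ¬ G.Adj u v) → I.card ≤ m)
    {D : ℝ} (hD₁ : 1 ≤ D)
    (hD : ∀ u v, G.Adj u v → ((G.neighborSet u).ncard : ℝ) +
      ((m : ℝ) - 1) / m * (G.neighborSet v).ncard + 1 ≤ D)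
    (U W : Finset V) (c : ℕ) (hUW : Disjoint U W) (hc : U.card + W.card * (1 - 1 / D) < c) :
    InducedPdLT K G U W c := by
  have hm0 : (0 : ℝ) < m := by exact_mod_cast hm
  have hα : 0 ≤ ((m : ℝ) - 1) / m := div_nonneg (by simpa using hm) hm0.le
  have hD0 : 0 < D := by linarith
  have hgain : 0 ≤ 1 - 1 / D := by
    rw [sub_nonneg, div_le_one hD0]; exact hD₁
  have hdeg : ∀ (B : Finset V) (a : V), {v ∈ B | G.Adj a v}.card ≤ (G.neighborSet a).ncard := by
    intro B a
    rw [← Set.ncard_coe_finset]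
    exact Set.ncard_le_ncard (fun v hv => (Finset.mem_filter.1 hv).2) (Set.toFinite _)
  induction W using Finset.strongInduction generalizing U with
  | H W ih =>
  by_cases hE : ∃ x ∈ W, ∃ y ∈ W, G.Adj x y
  swap
  · push Not at hE
    have hU : U.card + 1 ≤ c := by
      have : (0 : ℝ) ≤ W.card * (1 - 1 / D) := by positivity
      exact_mod_cast (by linarith : (U.card : ℝ) < c)
    have := (inducedPdLT_empty (K := K) (G := G) U).mono hU
    unfold InducedPdLT at this ⊢
    rwa [inducedEdgeIdeal_congr (W' := ∅) fun u v huv =>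
      ⟨fun h => (hE u h.1 v h.2 huv).elim, fun h => by simp at h⟩]
  obtain ⟨x, hxW, y, hyW, hxy⟩ := hE
  -- Moving `S` from `W` to `U` and deleting a further vertex preserves the numerical bound.
  have key : ∀ (S : Finset V) (a : V), S ⊆ W → a ∈ W → a ∉ S → (S.card : ℝ) + 1 ≤ D →
      InducedPdLT K G (U ∪ S) (W \ insert a S) c := by
    intro S a hSW haW haS hS
    have hsub : insert a S ⊆ W := Finset.insert_subset haW hSW
    refine ih _ (Finset.sdiff_ssubset hsub (Finset.insert_nonempty _ _)) _ ?_ ?_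
    · rw [Finset.disjoint_left] at hUW ⊢
      intro v hv hv'
      simp only [Finset.mem_union, Finset.mem_sdiff, Finset.mem_insert, not_or] at hv hv'
      exact hv.elim (fun h => hUW h hv'.1) hv'.2.2
    · have h1 : (((U ∪ S).card : ℕ) : ℝ) = U.card + S.card := by
        rw [Finset.card_union_of_disjoint (hUW.mono_right hSW)]; push_cast; ring
      have h2 : ((W \ insert a S).card : ℝ) = W.card - (S.card + 1) := by
        have := Finset.card_sdiff_add_card_eq_card hsub
        rw [Finset.card_insert_of_notMem haS] at this
        rw [← this]; push_cast; ring
      have h3 : (S.card + 1 : ℝ) / D ≤ 1 := (div_le_one hD0).2 hS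
      rw [h1, h2]
      calc (U.card + S.card + (W.card - (S.card + 1)) * (1 - 1 / D) : ℝ)
          = U.card + W.card * (1 - 1 / D) + ((S.card + 1 : ℝ) / D - 1) := by ring
        _ < c := by linarith
  set T : Finset V := {v ∈ W | G.Adj x v} with hT
  have hTW : T ⊆ W := Finset.filter_subset _ _
  have hTdeg : (T.card : ℝ) ≤ (G.neighborSet x).ncard := by exact_mod_cast hdeg W x
  have hTop : InducedPdLT K G (U ∪ T) (W \ T) c := by
    have hx := key T x hTW hxW (by simp [hT]) (by
      have := hD x y hxy
      have : 0 ≤ ((m : ℝ) - 1) / m * (G.neighborSet y).ncard := by positivity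
      linarith)
    unfold InducedPdLT at hx ⊢
    rwa [inducedEdgeIdeal_congr (W' := W \ insert x T)]
    intro u v huv
    simp only [hT, Finset.mem_sdiff, Finset.mem_insert, Finset.mem_filter]
    have := huv.symm
    constructor
    · rintro ⟨⟨h1, h2⟩, h3, h4⟩
      refine ⟨⟨h1, ?_⟩, h3, ?_⟩
      · rintro (rfl | h)
        · exact h4 ⟨h3, huv⟩
        · exact h2 h
      · rintro (rfl | h)
        · exact h2 ⟨h1, huv.symm⟩
        · exact h4 h
    · tauto
  obtain ⟨A, hA, hAmin⟩ := Finset.exists_min_image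
    {A ∈ T.powerset | InducedPdLT K G (U ∪ A) (W \ A) c} Finset.card ⟨T, by simp [hTop]⟩
  simp only [Finset.mem_filter, Finset.mem_powerset, and_imp] at hA hAmin
  obtain ⟨hAT, hA⟩ := hA
  rcases A.eq_empty_or_nonempty with rfl | hne
  · simpa using hA
  exfalso
  obtain ⟨a, haA, ha⟩ := exists_card_le_mul_card_filter_adj (G := G) hne (m := m)
    fun I hI => hind x I fun v hv => (Finset.mem_filter.1 (hAT (hI hv))).2
  have haW : a ∈ W := hTW (hAT haA)
  have hxa : G.Adj x a := (Finset.mem_filter.1 (hAT haA)).2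
  have hAW : A ⊆ W := hAT.trans hTW
  have hlt := Finset.card_erase_lt_of_mem haA
  refine absurd (hAmin (A.erase a) ((Finset.erase_subset _ _).trans hAT) ?_) (by omega)
  refine InducedPdLT.of_vertex (a := a) ?_ (by simp [haW]) ?_ ?_
  · have := Finset.disjoint_right.1 hUW haW
    simp [this]
  · set S : Finset V := A.erase a ∪ {v ∈ W | G.Adj a v} with hS
    have hSW : S ⊆ W := Finset.union_subset ((Finset.erase_subset _ _).trans hAW)
      (Finset.filter_subset _ _)
    have hScard : S.card ≤ {v ∈ A | ¬ (v = a ∨ G.Adj a v)}.card + {v ∈ W | G.Adj a v}.card := by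
      refine (Finset.card_le_card fun v hv => ?_).trans (Finset.card_union_le _ _)
      have := @hAW v
      simp only [hS, Finset.mem_union, Finset.mem_erase, Finset.mem_filter] at hv ⊢
      tauto
    have hcount := Finset.card_filter_add_card_filter_not (s := A) (fun v => v = a ∨ G.Adj a v)
    have hbound : (S.card : ℝ) + 1 ≤ D := by
      have h1 : (S.card : ℝ) ≤ {v ∈ A | ¬ (v = a ∨ G.Adj a v)}.card + (G.neighborSet a).ncard := by
        exact_mod_cast hScard.trans (Nat.add_le_add_left (hdeg W a) _)
      have h2 : ({v ∈ A | ¬ (v = a ∨ G.Adj a v)}.card : ℝ) =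
          A.card - {v ∈ A | v = a ∨ G.Adj a v}.card := by
        rw [← hcount]; push_cast; ring
      have h3 : (A.card : ℝ) / m ≤ {v ∈ A | v = a ∨ G.Adj a v}.card := by
        rw [div_le_iff₀ hm0, mul_comm]; exact_mod_cast ha
      have h4 : (A.card : ℝ) - A.card / m ≤ ((m : ℝ) - 1) / m * (G.neighborSet x).ncard := by
        have : (A.card : ℝ) ≤ (G.neighborSet x).ncard :=
          le_trans (by exact_mod_cast Finset.card_le_card hAT) hTdeg
        calc (A.card : ℝ) - A.card / m = ((m : ℝ) - 1) / m * A.card := by field_simp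
          _ ≤ _ := by gcongr
      have := hD a x hxa.symm
      linarith
    have hfin := key S a hSW haW (by simp [hS]) hbound
    convert hfin using 1
    · ext v
      simp only [hS, Finset.mem_union, Finset.mem_filter, Finset.mem_sdiff, Finset.mem_erase]
      tauto
    · ext v
      simp only [hS, Finset.mem_union, Finset.mem_filter, Finset.mem_sdiff, Finset.mem_erase,
        Finset.mem_insert]
      tauto
  · convert hA using 1
    · rw [← Finset.union_insert, Finset.insert_erase haA]
    · rw [← Finset.sdiff_insert, Finset.insert_erase haA]

end

theorem stmt4 (K : Type) [Field K] {V : Type} [Fintype V] (G : SimpleGraph V)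
    (m : ℕ) (hm : 1 ≤ m)
    (hfree : ¬ ∃ s : Set V,
      Nonempty (G.induce s ≃g completeBipartiteGraph (Fin 1) (Fin (m + 1))))
    (x y : V) (hmax : IsAlphaMaxEdge G (((m : ℝ) - 1) / m) x y)
    (hde : (G.neighborSet y).ncard ≤ (G.neighborSet x).ncard) :
    ((graphPd K G : ℝ≥0∞) : EReal) ≤
      (((Fintype.card V : ℝ) *
        (1 - 1 / (((G.neighborSet x).ncard : ℝ)
          + ((m : ℝ) - 1) / m * ((G.neighborSet y).ncard : ℝ) + 1))) : EReal) := by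
  classical
  obtain ⟨hxy, hmax⟩ := hmax
  set D : ℝ := ((G.neighborSet x).ncard : ℝ)
    + ((m : ℝ) - 1) / m * ((G.neighborSet y).ncard : ℝ) + 1 with hD
  have hα : 0 ≤ ((m : ℝ) - 1) / m := div_nonneg (by simpa using hm) (by positivity)
  have hD₁ : 1 ≤ D := by
    have : 0 ≤ ((m : ℝ) - 1) / m * ((G.neighborSet y).ncard : ℝ) := by positivity
    have : (0 : ℝ) ≤ (G.neighborSet x).ncard := by positivity
    linarith
  set B : ℝ := (Fintype.card V : ℝ) * (1 - 1 / D) with hB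
  have hB0 : 0 ≤ B := by
    refine mul_nonneg (by positivity) ?_
    rw [sub_nonneg, div_le_one (by linarith)]
    exact hD₁
  have hind : ∀ z : V, ∀ I : Finset V, (∀ v ∈ I, G.Adj z v) →
      (∀ u ∈ I, ∀ v ∈ I, ¬ G.Adj u v) → I.card ≤ m := by
    intro z I hz hI
    by_contra! hlt
    obtain ⟨I', hI', hcard⟩ := Finset.exists_subset_card_eq (Nat.succ_le_of_lt hlt)
    exact hfree (exists_iso_completeBipartiteGraph (fun v hv => hz v (hI' hv))
      (fun u hu v hv => hI u (hI' hu) v (hI' hv)) hcard)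
  have hle : graphPd K G ≤ (⌊B⌋₊ : ℕ∞) := by
    refine sSup_le ?_
    rintro _ ⟨i, N, rfl, hN⟩
    rw [Nat.cast_le]
    by_contra! hlt
    have hBi : B < i := (Nat.floor_lt hB0).1 hlt
    have hpd := inducedPdLT_of_lt (K := K) hm hind hD₁
      (fun u v huv => by have := hmax u v huv; linarith) ∅ Finset.univ i (by simp)
      (by simpa [hB] using hBi)
    unfold InducedPdLT at hpd
    rw [← edgeIdeal_eq_inducedEdgeIdeal] at hpd
    exact not_subsingleton_iff_nontrivial.2 hN
      (subsingleton_Ext_of_hasProjectiveDimensionLT hpd le_rfl (by omega))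
  calc ((graphPd K G : ℝ≥0∞) : EReal) ≤ (((⌊B⌋₊ : ℕ∞) : ℝ≥0∞) : EReal) := by
        exact_mod_cast hle
    _ = ((⌊B⌋₊ : ℝ) : EReal) := rfl
    _ ≤ (B : EReal) := by exact_mod_cast Nat.floor_le hB0
end

section
/- Let ℓ ≥ 1 and let G be a finite simple graph with n vertices whose vertex set is a subset of ℤ^ℓ and such that every edge of G joins two points of ℤ^ℓ that differ by ±1 in exactly one coordinate (i.e., G is a finite subgraph of the ℤ^ℓ lattice). Then pd(G) ≤ n(1 − 1/(2ℓ + 1)). -/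
open CategoryTheory
open scoped ENNReal

/-- Two points of `ℤ^ℓ` are adjacent in the lattice when they differ by `±1` in exactly
one coordinate. -/
def latticeAdj (ℓ : ℕ) (a b : Fin ℓ → ℤ) : Prop :=
  ∃ i, (a i - b i = 1 ∨ b i - a i = 1) ∧ ∀ j, j ≠ i → a j = b j

section ProjectiveDimension

open CategoryTheory.Limits

theorem CategoryTheory.HasProjectiveDimensionLT.isZero_Ext {R C : Type*} [Ring R] [Category* C]
    [Abelian C] [Linear R C] [EnoughProjectives C] (X Y : C) {n i : ℕ}
    [HasProjectiveDimensionLT X n] (h : n ≤ i + 1) :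
    IsZero (((Ext R C (i + 1)).obj (Opposite.op X)).obj Y) := by
  let := HasExt.standard C
  let P := ProjectiveResolution.of X
  refine IsZero.of_iso ?_ (P.isoExt (i + 1) Y)
  rw [← HomologicalComplex.exactAt_iff_isZero_homology,
    HomologicalComplex.exactAt_iff' _ i (i + 1) (i + 2) (by simp) (by simp),
    ShortComplex.moduleCat_exact_iff]
  intro (f : P.complex.X (i + 1) ⟶ Y) (hf : P.complex.d (i + 2) (i + 1) ≫ f = 0)
  exact (P.extMk_eq_zero_iff f (i + 2) rfl hf i rfl).1
    (Abelian.Ext.eq_zero_of_hasProjectiveDimensionLT _ n h)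

theorem projDim_le_of_hasProjectiveDimensionLE {R : Type} [CommRing R] (M : ModuleCat R) (p : ℕ)
    [HasProjectiveDimensionLE M p] : projDim R M ≤ p := by
  refine sSup_le ?_
  rintro _ ⟨i, N, rfl, hN⟩
  rw [Nat.cast_le]
  by_contra! hi
  obtain ⟨j, rfl⟩ := Nat.exists_eq_add_of_lt hi
  exact not_subsingleton_iff_nontrivial.2 hN <| ModuleCat.subsingleton_of_isZero <|
    HasProjectiveDimensionLT.isZero_Ext M N (n := p + 1) (by lia)

end ProjectiveDimension

namespace Ideal

universe u

variable {R : Type u} [CommRing R] {I J : Ideal R} {x : R}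

/-- The complex `R ⧸ J ⟶ R ⧸ I ⟶ R ⧸ (I ⊔ (x))` given by multiplication by `x` and projection. -/
noncomputable def colonShortComplex (h : ∀ f, f * x ∈ I ↔ f ∈ J) :
    ShortComplex (ModuleCat.{u} R) :=
  ShortComplex.moduleCatMk
    (Submodule.mapQ J I (LinearMap.lsmul R R x)
      fun f hf ↦ by simpa [mul_comm x] using (h f).2 hf : (R ⧸ J) →ₗ[R] R ⧸ I)
    (Submodule.factor le_sup_left : (R ⧸ I) →ₗ[R] R ⧸ (I ⊔ span {x})) <| by
      refine Submodule.linearMap_qext _ (LinearMap.ext fun f ↦ ?_)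
      exact (Submodule.Quotient.mk_eq_zero _).2
        (mem_sup_right (mem_span_singleton.2 (Dvd.intro f rfl)))

theorem colonShortComplex_shortExact (h : ∀ f, f * x ∈ I ↔ f ∈ J) :
    (colonShortComplex h).ShortExact := by
  refine ModuleCat.shortComplex_shortExact _ ?_ ?_ ?_
  · intro y
    obtain ⟨f, rfl⟩ := Submodule.Quotient.mk_surjective _ y
    constructor
    · intro hf
      obtain ⟨g, hg, z, hz, rfl⟩ := Submodule.mem_sup.1 ((Submodule.Quotient.mk_eq_zero _).1 hf)
      obtain ⟨c, rfl⟩ := mem_span_singleton.1 hz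
      refine ⟨Submodule.Quotient.mk c, (Submodule.Quotient.eq _).2 ?_⟩
      simpa using hg
    · rintro ⟨z, hz⟩
      obtain ⟨c, rfl⟩ := Submodule.Quotient.mk_surjective _ z
      rw [← hz]
      exact (Submodule.Quotient.mk_eq_zero _).2
        (mem_sup_right (mem_span_singleton.2 (Dvd.intro c rfl)))
  · refine (injective_iff_map_eq_zero (colonShortComplex h).f.hom).2 fun y hy ↦ ?_
    obtain ⟨f, rfl⟩ := Submodule.Quotient.mk_surjective _ y
    refine (Submodule.Quotient.mk_eq_zero _).2 ((h f).1 ?_)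
    rw [mul_comm]
    exact (Submodule.Quotient.mk_eq_zero _).1 hy
  · exact Submodule.factor_surjective le_sup_left

theorem hasProjectiveDimensionLT_quotient_of_colon (h : ∀ f, f * x ∈ I ↔ f ∈ J) {n : ℕ}
    (hJ : HasProjectiveDimensionLT (ModuleCat.of R (R ⧸ J)) n)
    (hx : HasProjectiveDimensionLT (ModuleCat.of R (R ⧸ (I ⊔ span {x}))) n) :
    HasProjectiveDimensionLT (ModuleCat.of R (R ⧸ I)) n :=
  (colonShortComplex_shortExact h).hasProjectiveDimensionLT_X₂ n hJ hx

theorem hasProjectiveDimensionLT_quotient_sup_span_singleton (h : ∀ f, f * x ∈ I ↔ f ∈ J) {n : ℕ}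
    (hJ : HasProjectiveDimensionLT (ModuleCat.of R (R ⧸ J)) n)
    (hI : HasProjectiveDimensionLT (ModuleCat.of R (R ⧸ I)) (n + 1)) :
    HasProjectiveDimensionLT (ModuleCat.of R (R ⧸ (I ⊔ span {x}))) (n + 1) :=
  (colonShortComplex_shortExact h).hasProjectiveDimensionLT_X₃ n hJ hI

end Ideal

section EdgeIdeal

open MvPolynomial

variable (K : Type) [Field K] {V : Type} (G : SimpleGraph V)

/-- The ideal generated by the edge ideal of `G` and the variables indexed by `A`; up to these
variables it is the edge ideal of the graph obtained from `G` by deleting `A`. -/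
noncomputable def edgeIdealSup (A : Set V) : Ideal (MvPolynomial V K) :=
  edgeIdeal K G ⊔ Ideal.span (X '' A)

variable {K G}

theorem mem_edgeIdealSup_iff {A : Set V} {f : MvPolynomial V K} :
    f ∈ edgeIdealSup K G A ↔ ∀ m ∈ f.support,
      (∃ a ∈ A, m a ≠ 0) ∨ ∃ u v, G.Adj u v ∧ m u ≠ 0 ∧ m v ≠ 0 := by
  classical
  have key : edgeIdealSup K G A = Ideal.span ((fun m ↦ monomial m (1 : K)) ''
      ({m | ∃ u v, G.Adj u v ∧ m = Finsupp.single u 1 + Finsupp.single v 1} ∪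
        (fun a ↦ Finsupp.single a 1) '' A)) := by
    rw [edgeIdealSup, edgeIdeal, ← Ideal.span_union, Set.image_union, Set.image_image]
    congr 2
    ext f
    simp only [Set.mem_ofPred_eq, Set.mem_image, X, monomial_mul, mul_one]
    constructor
    · rintro ⟨u, v, h, rfl⟩
      exact ⟨_, ⟨u, v, h, rfl⟩, rfl⟩
    · rintro ⟨_, ⟨u, v, h, rfl⟩, rfl⟩
      exact ⟨u, v, h, rfl⟩
  rw [key, mem_ideal_span_monomial_image]
  refine forall₂_congr fun m _ ↦ ?_
  constructor
  · rintro ⟨_, ⟨u, v, h, rfl⟩ | ⟨a, ha, rfl⟩, hm⟩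
    · have hu := hm u
      have hv := hm v
      simp only [Finsupp.add_apply, Finsupp.single_eq_same] at hu hv
      exact .inr ⟨u, v, h, by lia, by lia⟩
    · have := hm a
      simp only [Finsupp.single_eq_same] at this
      exact .inl ⟨a, ha, by lia⟩
  · rintro (⟨a, ha, hm⟩ | ⟨u, v, h, hu, hv⟩)
    · exact ⟨_, .inr ⟨a, ha, rfl⟩, Finsupp.single_le_iff.2 (by lia)⟩
    · refine ⟨_, .inl ⟨u, v, h, rfl⟩, fun w ↦ ?_⟩
      have := h.ne
      simp only [Finsupp.add_apply, Finsupp.single_apply]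
      grind

theorem edgeIdealSup_sup_span_X (A : Set V) (v : V) :
    edgeIdealSup K G A ⊔ Ideal.span {X v} = edgeIdealSup K G (insert v A) := by
  rw [edgeIdealSup, edgeIdealSup, Set.image_insert_eq, Ideal.span_insert, sup_assoc,
    sup_comm (Ideal.span {X v})]

theorem mul_X_mem_edgeIdealSup_iff {A : Set V} {v : V} (hv : v ∉ A) (f : MvPolynomial V K) :
    f * X v ∈ edgeIdealSup K G A ↔ f ∈ edgeIdealSup K G (A ∪ G.neighborSet v) := by
  classical
  simp only [mem_edgeIdealSup_iff, support_mul_X, Finset.mem_map, addRightEmbedding_apply,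
    forall_exists_index, and_imp, forall_apply_eq_imp_iff₂, Finsupp.add_apply,
    Finsupp.single_apply, Set.mem_union, SimpleGraph.mem_neighborSet]
  refine forall₂_congr fun m _ ↦ ?_
  constructor
  · rintro (⟨a, ha, hm⟩ | ⟨u, w, h, hu, hw⟩)
    · exact .inl ⟨a, .inl ha, by grind⟩
    · have := h.symm
      have := h.ne
      grind
  · rintro (⟨a, ha | ha, hm⟩ | ⟨u, w, h, hu, hw⟩)
    · exact .inl ⟨a, ha, by lia⟩
    · exact .inr ⟨v, a, ha, by simp, by lia⟩
    · exact .inr ⟨u, w, h, by lia, by lia⟩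

theorem edgeIdealSup_bot_empty : edgeIdealSup K (⊥ : SimpleGraph V) ∅ = ⊥ := by
  simp [edgeIdealSup, edgeIdeal]

theorem edgeIdealSup_empty : edgeIdealSup K G ∅ = edgeIdeal K G := by
  simp [edgeIdealSup]

theorem edgeIdealSup_eq_of_isVertexCover {A : Set V} (h : G.IsVertexCover A) :
    edgeIdealSup K G A = edgeIdealSup K ⊥ A := by
  ext f
  simp only [mem_edgeIdealSup_iff, SimpleGraph.bot_adj, false_and, exists_false, or_false]
  refine forall₂_congr fun m _ ↦ ⟨?_, .inl⟩
  rintro (hm | ⟨u, v, huv, hu, hv⟩)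
  · exact hm
  · exact (h huv).elim (⟨u, ·, hu⟩) (⟨v, ·, hv⟩)

theorem hasProjectiveDimensionLE_quotient_edgeIdealSup_bot (A : Finset V) :
    HasProjectiveDimensionLE (ModuleCat.of (MvPolynomial V K)
      (MvPolynomial V K ⧸ edgeIdealSup K (⊥ : SimpleGraph V) A)) A.card := by
  classical
  induction A using Finset.induction with
  | empty =>
    rw [Finset.coe_empty, edgeIdealSup_bot_empty, Finset.card_empty,
      ← projective_iff_hasProjectiveDimensionLE_zero]
    exact Projective.of_iso
      (Submodule.quotEquivOfEqBot (⊥ : Ideal (MvPolynomial V K)) rfl).symm.toModuleIso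
      (ModuleCat.projective_of_free (Module.Basis.singleton Unit _))
  | insert a A ha ih =>
    rw [Finset.coe_insert, Finset.card_insert_of_notMem ha, ← edgeIdealSup_sup_span_X]
    refine Ideal.hasProjectiveDimensionLT_quotient_sup_span_singleton (fun f ↦ ?_) ih
      (hasProjectiveDimensionLT_of_ge _ (A.card + 1) _ (Nat.le_succ _))
    rw [mul_X_mem_edgeIdealSup_iff (by exact_mod_cast ha)]
    simp [SimpleGraph.neighborSet]

theorem hasProjectiveDimensionLT_quotient_edgeIdealSup {A : Set V} {v : V} (hv : v ∉ A) {n : ℕ}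
    (h₁ : HasProjectiveDimensionLT (ModuleCat.of (MvPolynomial V K)
      (MvPolynomial V K ⧸ edgeIdealSup K G (A ∪ G.neighborSet v))) n)
    (h₂ : HasProjectiveDimensionLT (ModuleCat.of (MvPolynomial V K)
      (MvPolynomial V K ⧸ edgeIdealSup K G (insert v A))) n) :
    HasProjectiveDimensionLT (ModuleCat.of (MvPolynomial V K)
      (MvPolynomial V K ⧸ edgeIdealSup K G A)) n :=
  Ideal.hasProjectiveDimensionLT_quotient_of_colon (mul_X_mem_edgeIdealSup_iff hv) h₁
    (by rwa [edgeIdealSup_sup_span_X])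

end EdgeIdeal

section Elimination

open Finset

open scoped Classical in
/-- The vertices that are not isolated in the graph obtained from `G` by deleting `A`. -/
noncomputable def nonisolatedVerts {V : Type} [Fintype V] (G : SimpleGraph V) (A : Finset V) :
    Finset V :=
  {v | v ∉ A ∧ ∃ w ∉ A, G.Adj v w}

variable {V : Type} [Fintype V] {G : SimpleGraph V} {A B : Finset V} {u v w : V}

theorem mem_nonisolatedVerts : v ∈ nonisolatedVerts G A ↔ v ∉ A ∧ ∃ w ∉ A, G.Adj v w := by
  simp [nonisolatedVerts]

theorem nonisolatedVerts_anti (h : A ⊆ B) : nonisolatedVerts G B ⊆ nonisolatedVerts G A := by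
  intro v
  simp only [mem_nonisolatedVerts]
  exact fun ⟨hv, w, hw, hvw⟩ ↦ ⟨mt (@h v) hv, w, mt (@h w) hw, hvw⟩

theorem card_nonisolatedVerts_add_le [DecidableEq V]
    (hBA : B ⊆ nonisolatedVerts G A) (hu : u ∈ nonisolatedVerts G A) (huB : u ∉ B)
    (hN : ∀ w, G.Adj u w → w ∈ A ∪ B) :
    #(nonisolatedVerts G (A ∪ B)) + #B + 1 ≤ #(nonisolatedVerts G A) := by
  have hd : Disjoint (nonisolatedVerts G (A ∪ B)) (insert u B) := by
    refine disjoint_left.2 fun x hx hxB ↦ ?_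
    obtain ⟨hxA, y, hy, hxy⟩ := mem_nonisolatedVerts.1 hx
    obtain rfl | hxB := mem_insert.1 hxB
    · exact hy (hN y hxy)
    · exact hxA (mem_union_right _ hxB)
  rw [add_assoc, ← card_insert_of_notMem huB, ← card_union_of_disjoint hd]
  exact card_le_card (union_subset (nonisolatedVerts_anti subset_union_left)
    (insert_subset hu hBA))

open scoped Classical in
/-- If after every deletion of vertices the neighbours of some nonisolated vertex can be eliminated
one after the other so that the `i`-th one has at most `d - i` remaining neighbours (counting
from `i = 0`), then the quotient by `edgeIdealSup K G A` has projective dimension at most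
`#A + d / (d + 1) * #(nonisolatedVerts G A)`. -/
theorem hasProjectiveDimensionLE_quotient_edgeIdealSup (K : Type) [Field K] (G : SimpleGraph V)
    {d : ℕ} (p : ℕ)
    (hG : ∀ A : Finset V, (nonisolatedVerts G A).Nonempty → ∃ v ∈ nonisolatedVerts G A,
      ∃ f : V → ℕ, Set.InjOn f (G.neighborFinset v \ A : Finset V) ∧
        ∀ w ∈ G.neighborFinset v \ A, f w + #(G.neighborFinset w \ A) ≤ d)
    (A : Finset V) (hA : (d + 1) * #A + d * #(nonisolatedVerts G A) < (d + 1) * (p + 1)) :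
    HasProjectiveDimensionLE (ModuleCat.of (MvPolynomial V K)
      (MvPolynomial V K ⧸ edgeIdealSup K G A)) p := by
  induction A using WellFoundedGT.induction with
  | _ A ih =>
  obtain hU | hU := (nonisolatedVerts G A).eq_empty_or_nonempty
  · have hcover : G.IsVertexCover (A : Set V) := by
      intro x y hxy
      by_contra! h
      have : x ∈ nonisolatedVerts G A := mem_nonisolatedVerts.2 ⟨h.1, y, h.2, hxy⟩
      simp [hU] at this
    rw [edgeIdealSup_eq_of_isVertexCover hcover]
    have := hasProjectiveDimensionLE_quotient_edgeIdealSup_bot (K := K) A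
    rw [hU, card_empty, mul_zero, add_zero] at hA
    exact hasProjectiveDimensionLT_of_ge _ (#A + 1) _ (lt_of_mul_lt_mul_left' hA)
  obtain ⟨v, hv, f, hf, hd⟩ := hG A hU
  obtain ⟨hvA, w₀, hw₀A, hvw₀⟩ := mem_nonisolatedVerts.1 hv
  have step {B : Finset V} (hB : B.Nonempty) (hBd : #B ≤ d) (hBA : B ⊆ nonisolatedVerts G A)
      {u : V} (hu : u ∈ nonisolatedVerts G A) (huB : u ∉ B)
      (hN : ∀ w, G.Adj u w → w ∈ A ∪ B) :
      HasProjectiveDimensionLE (ModuleCat.of (MvPolynomial V K)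
        (MvPolynomial V K ⧸ edgeIdealSup K G (A ∪ B : Finset V))) p := by
    have hdisj : Disjoint A B :=
      disjoint_right.2 fun x hx ↦ (mem_nonisolatedVerts.1 (hBA hx)).1
    refine ih (A ∪ B) (Finset.ssubset_iff_subset_ne.2 ⟨subset_union_left, fun h ↦ ?_⟩) ?_
    · obtain ⟨b, hb⟩ := hB
      exact disjoint_right.1 hdisj hb (h ▸ mem_union_right A hb)
    · have := Nat.mul_le_mul_left d (card_nonisolatedVerts_add_le hBA hu huB hN)
      rw [card_union_of_disjoint hdisj]
      linarith
  let N := G.neighborFinset v \ A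
  have hmem {x y : V} (hx : x ∉ A) (hy : y ∈ G.neighborFinset x \ A) :
      y ∈ nonisolatedVerts G A := by
    simp only [mem_sdiff, SimpleGraph.mem_neighborFinset] at hy
    exact mem_nonisolatedVerts.2 ⟨hy.2, x, hx, hy.1.symm⟩
  have hpos {w : V} (hw : w ∈ N) : 1 ≤ #(G.neighborFinset w \ A) := by
    refine card_pos.2 ⟨v, ?_⟩
    simp only [N, mem_sdiff, SimpleGraph.mem_neighborFinset] at hw ⊢
    exact ⟨hw.1.symm, hvA⟩
  have hcard (i : ℕ) : #{w ∈ N | f w < i} ≤ i := by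
    refine (card_le_card_of_injOn f (t := range i) ?_ (hf.mono ?_)).trans (card_range i).le
    · intro w hw
      simpa using (mem_filter.1 hw).2
    · exact fun w hw ↦ (mem_filter.1 hw).1
  have hlt {w : V} (hw : w ∈ N) : f w < d := by
    have := hd w hw
    have := hpos hw
    lia
  have hall : {w ∈ N | f w < d} = N := filter_true_of_mem fun w hw ↦ hlt hw
  have main (j : ℕ) (i : ℕ) (hij : i + j = d) : HasProjectiveDimensionLE
      (ModuleCat.of (MvPolynomial V K)
        (MvPolynomial V K ⧸ edgeIdealSup K G (A ∪ {w ∈ N | f w < i} : Finset V))) p := by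
    induction j generalizing i with
    | zero =>
      obtain rfl : i = d := hij
      have := hcard i
      rw [hall] at this ⊢
      refine step ⟨w₀, by simp [N, hvw₀, hw₀A]⟩ this (fun y hy ↦ hmem hvA hy) hv
        (by simp [N]) fun w hw ↦ ?_
      simp only [N, mem_union, mem_sdiff, SimpleGraph.mem_neighborFinset]
      tauto
    | succ j ihj =>
      specialize ihj (i + 1) (by lia)
      by_cases! hi : ∀ w ∈ N, f w ≠ i
      · rwa [filter_congr fun w hw ↦ show f w < i + 1 ↔ f w < i by have := hi w hw; lia] at ihj
      obtain ⟨w, hw, hwi⟩ := hi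
      have hwA : w ∉ A := (mem_sdiff.1 hw).2
      refine hasProjectiveDimensionLT_quotient_edgeIdealSup (v := w) ?_ ?_ ?_
      · simp [hwA, hwi]
      · have := step (u := w) (B := {w ∈ N | f w < i} ∪ (G.neighborFinset w \ A))
          (.inr (card_pos.1 (hpos hw)))
          ((card_union_le _ _).trans ((Nat.add_le_add_right (hcard i) _).trans (hwi ▸ hd w hw)))
          (union_subset (fun y hy ↦ hmem hvA (mem_filter.1 hy).1) fun y hy ↦ hmem hwA hy)
          (hmem hvA hw) (by simp [hwi]) (fun x hx ↦ by simp [hx]; tauto)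
        have heq : ((A ∪ {w ∈ N | f w < i} : Finset V) : Set V) ∪ G.neighborSet w =
            (A ∪ ({w ∈ N | f w < i} ∪ (G.neighborFinset w \ A)) : Finset V) := by
          ext x
          simp only [Set.mem_union, mem_coe, mem_union, mem_sdiff,
            SimpleGraph.mem_neighborFinset, SimpleGraph.mem_neighborSet]
          tauto
        rwa [heq]
      · have heq : insert w ((A ∪ {w ∈ N | f w < i} : Finset V) : Set V) =
            (A ∪ {w ∈ N | f w < i + 1} : Finset V) := by
          ext x
          have : f x = i → x ∈ N → x = w := fun hx hxN ↦ hf hxN hw (hx.trans hwi.symm)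
          simp only [Set.mem_insert_iff, mem_coe, mem_union, mem_filter]
          grind
        rwa [heq]
  have hA₀ : A ∪ {w ∈ N | f w < 0} = A := by simp
  exact hA₀ ▸ main d 0 (zero_add d)

end Elimination

section Lattice

open Finset

variable {ℓ : ℕ} {a b : Fin ℓ → ℤ}

theorem latticeAdj_iff :
    latticeAdj ℓ a b ↔ ∃ i, b = a + Pi.single i 1 ∨ b = a - Pi.single i 1 := by
  refine exists_congr fun i ↦ ?_
  simp only [funext_iff, Pi.add_apply, Pi.sub_apply, Pi.single_apply]
  constructor
  · rintro ⟨h | h, h'⟩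
    · refine .inr fun j ↦ ?_
      have := h' j
      grind
    · refine .inl fun j ↦ ?_
      have := h' j
      grind
  · rintro (h | h)
    · exact ⟨.inr (by simp [h]), fun j hj ↦ by simp [h, hj]⟩
    · exact ⟨.inl (by simp [h]), fun j hj ↦ by simp [h, hj]⟩

theorem toLex_sub_single_lt (a : Fin ℓ → ℤ) (i : Fin ℓ) : toLex (a - Pi.single i 1) < toLex a :=
  Pi.toLex_strictMono (sub_lt_self a (Pi.single_pos.2 one_pos))

theorem toLex_add_single_sub_single_lt (a : Fin ℓ → ℤ) {i j : Fin ℓ} (h : i < j) :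
    toLex (a + Pi.single j 1 - Pi.single i 1) < toLex a := by
  refine ⟨i, fun k hk ↦ ?_, ?_⟩
  · simp [hk.ne, (hk.trans h).ne]
  · simp [h.ne]

open scoped Classical in
theorem exists_elimination_of_latticeAdj {s : Set (Fin ℓ → ℤ)} [Fintype s] {G : SimpleGraph s}
    (hsub : ∀ u v : s, G.Adj u v → latticeAdj ℓ (u : Fin ℓ → ℤ) (v : Fin ℓ → ℤ)) (A : Finset s)
    (hA : (nonisolatedVerts G A).Nonempty) : ∃ v ∈ nonisolatedVerts G A,
      ∃ f : s → ℕ, Set.InjOn f (G.neighborFinset v \ A : Finset s) ∧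
        ∀ w ∈ G.neighborFinset v \ A, f w + #(G.neighborFinset w \ A) ≤ 2 * ℓ := by
  obtain ⟨v, hv, hmin⟩ := exists_min_image _ (fun x : s ↦ toLex (x : Fin ℓ → ℤ)) hA
  have hvA := (mem_nonisolatedVerts.1 hv).1
  have hlex {x y : s} (hx : x ∉ A) (hy : y ∈ G.neighborFinset x \ A) :
      toLex (v : Fin ℓ → ℤ) ≤ toLex (y : Fin ℓ → ℤ) := by
    simp only [mem_sdiff, SimpleGraph.mem_neighborFinset] at hy
    exact hmin y (mem_nonisolatedVerts.2 ⟨hy.2, x, hx, hy.1.symm⟩)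
  have hex (w : s) (hw : w ∈ G.neighborFinset v \ A) :
      ∃ i : Fin ℓ, (w : Fin ℓ → ℤ) = (v : Fin ℓ → ℤ) + Pi.single i 1 := by
    obtain ⟨i, h | h⟩ := latticeAdj_iff.1 (hsub v w (by simpa using (mem_sdiff.1 hw).1))
    · exact ⟨i, h⟩
    · exact absurd (hlex hvA hw) (h ▸ toLex_sub_single_lt _ i).not_ge
  have hex' (w : s) : ∃ n : ℕ, ∀ hw : w ∈ G.neighborFinset v \ A,
      ∃ i : Fin ℓ, (i : ℕ) = n ∧ (w : Fin ℓ → ℤ) = (v : Fin ℓ → ℤ) + Pi.single i 1 := by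
    by_cases hw : w ∈ G.neighborFinset v \ A
    · obtain ⟨i, hi⟩ := hex w hw
      exact ⟨i, fun _ ↦ ⟨i, rfl, hi⟩⟩
    · exact ⟨0, fun h ↦ absurd h hw⟩
  choose f hf using hex'
  refine ⟨v, hv, f, fun x hx y hy hxy ↦ ?_, fun w hw ↦ ?_⟩
  · obtain ⟨i, hi, hxi⟩ := hf x hx
    obtain ⟨j, hj, hyj⟩ := hf y hy
    obtain rfl : i = j := Fin.ext (by lia)
    exact Subtype.ext (hxi.trans hyj.symm)
  · obtain ⟨j, hj, hwj⟩ := hf w hw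
    have hsubset : (G.neighborFinset w \ A).map (Function.Embedding.subtype _) ⊆
        univ.image (fun i ↦ (w : Fin ℓ → ℤ) + Pi.single i 1) ∪
          (Ici j).image fun i ↦ (w : Fin ℓ → ℤ) - Pi.single i 1 := by
      intro x hx
      obtain ⟨y, hy, rfl⟩ := mem_map.1 hx
      obtain ⟨i, h | h⟩ := latticeAdj_iff.1 (hsub w y (by simpa using (mem_sdiff.1 hy).1))
      · exact mem_union_left _ (mem_image.2 ⟨i, mem_univ i, h.symm⟩)
      · refine mem_union_right _ (mem_image.2 ⟨i, mem_Ici.2 (not_lt.1 fun hij ↦ ?_), h.symm⟩)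
        rw [hwj] at h
        exact (hlex (mem_sdiff.1 hw).2 hy).not_gt (h ▸ toLex_add_single_sub_single_lt _ hij)
    have hle := (card_le_card hsubset).trans
      ((card_union_le _ _).trans (Nat.add_le_add card_image_le card_image_le))
    rw [card_map, card_univ, Fintype.card_fin, Fin.card_Ici] at hle
    have := j.isLt
    lia

end Lattice

theorem stmt5 (K : Type) [Field K] (ℓ : ℕ) (hl : 1 ≤ ℓ)
    (s : Set (Fin ℓ → ℤ)) (hs : s.Finite) (G : SimpleGraph s)
    (hsub : ∀ u v : s, G.Adj u v → latticeAdj ℓ (u : Fin ℓ → ℤ) (v : Fin ℓ → ℤ)) :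
    ((graphPd K G : ℝ≥0∞) : EReal) ≤
      (((s.ncard : ℝ) * (1 - 1 / (2 * (ℓ : ℝ) + 1))) : EReal) := by
  classical
  have := hs.fintype
  let p := 2 * ℓ * s.ncard / (2 * ℓ + 1)
  have hp : HasProjectiveDimensionLE (ModuleCat.of (MvPolynomial s K)
      (MvPolynomial s K ⧸ edgeIdeal K G)) p := by
    have h := hasProjectiveDimensionLE_quotient_edgeIdealSup K G p
      (fun A hA ↦ by convert exists_elimination_of_latticeAdj hsub A hA) ∅ ?_
    · rwa [Finset.coe_empty, edgeIdealSup_empty] at h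
    · have hcard : (nonisolatedVerts G ∅).card ≤ s.ncard := by
        rw [Set.ncard_eq_toFinset_card', Set.toFinset_card]
        exact Finset.card_le_univ _
      rw [Finset.card_empty, mul_zero, zero_add]
      exact (Nat.mul_le_mul_left _ hcard).trans_lt (Nat.lt_mul_div_succ _ (by lia))
  have hpd : graphPd K G ≤ p := projDim_le_of_hasProjectiveDimensionLE _ p
  have hreal : (p : ℝ) ≤ (s.ncard : ℝ) * (1 - 1 / (2 * (ℓ : ℝ) + 1)) := by
    refine (Nat.cast_div_le).trans (le_of_eq ?_)
    push_cast
    field_simp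
    ring
  have hcoe : (((s.ncard : ℝ) * (1 - 1 / (2 * (ℓ : ℝ) + 1)) : ℝ) : EReal) =
      (((s.ncard : ℝ) * (1 - 1 / (2 * (ℓ : ℝ) + 1))) : EReal) := by
    push_cast [EReal.coe_div]
    rfl
  calc ((graphPd K G : ℝ≥0∞) : EReal) ≤ (((p : ℕ∞) : ℝ≥0∞) : EReal) := by
        exact_mod_cast hpd
    _ = ((p : ℝ) : EReal) := by simp [← ENNReal.ofReal_natCast]
    _ ≤ _ := hcoe ▸ EReal.coe_le_coe_iff.2 hreal
end

section
/- Let m ≥ 1 and let G be a finite simple graph on n vertices with at least one edge such that G has no independent set of size m + 1 (equivalently, the independence complex of G has dimension < m). Let (x, y) be an ((m−1)/m)-max edge of G, with d = deg(x) ≥ deg(y) = e. Then pd(G) ≤ n(1 − 1/(d + ((m−1)/m)·e + 1)). -/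
open CategoryTheory
open scoped ENNReal

/-- A set of vertices is independent if no two of its vertices are adjacent. -/
def IsIndepSet {V : Type} (G : SimpleGraph V) (A : Set V) : Prop :=
  ∀ u ∈ A, ∀ v ∈ A, ¬ G.Adj u v

/-- The derived-functor `Ext` of `ModuleCat R` vanishes above the projective dimension. -/
lemma subsingleton_ext_of_hasProjectiveDimensionLT {R : Type} [CommRing R] (M N : ModuleCat.{0} R)
    (n : ℕ) [HasProjectiveDimensionLT M (n + 1)] :
    Subsingleton (((Ext R (ModuleCat R) (n + 1)).obj (Opposite.op M)).obj N) := by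
  let P : ProjectiveResolution M := ProjectiveResolution.of M
  apply ModuleCat.subsingleton_of_isZero
  refine Limits.IsZero.of_iso ?_ (P.isoExt (n + 1) N)
  rw [← HomologicalComplex.exactAt_iff_isZero_homology,
    HomologicalComplex.exactAt_iff' _ n (n + 1) (n + 2) (by simp) (by simp),
    ShortComplex.moduleCat_exact_iff]
  intro f hf
  obtain ⟨g, hg⟩ := (P.extMk_eq_zero_iff (Y := N) (n := n + 1) f (n + 2) rfl hf n rfl).1
    (Abelian.Ext.eq_zero_of_hasProjectiveDimensionLT _ (n + 1) le_rfl)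
  exact ⟨g, hg⟩

lemma projDim_le_of_hasProjectiveDimensionLT {R : Type} [CommRing R] (M : ModuleCat.{0} R)
    (n : ℕ) [HasProjectiveDimensionLT M (n + 1)] : projDim R M ≤ n := by
  refine sSup_le ?_
  rintro _ ⟨i, N, rfl, hi⟩
  by_contra! hlt
  obtain ⟨j, rfl⟩ := Nat.exists_eq_add_of_lt (Nat.cast_lt.1 hlt)
  have : HasProjectiveDimensionLT M (n + j + 1) :=
    hasProjectiveDimensionLT_of_ge M (n + 1) _ (by lia)
  exact not_nontrivial_iff_subsingleton.2
    (subsingleton_ext_of_hasProjectiveDimensionLT M N (n + j)) hi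

/-- The short exact sequence `0 → R ⧸ (I : f) → R ⧸ I → R ⧸ (I + (f)) → 0`. -/
lemma exists_shortExact_quotient_colon {R : Type} [CommRing R] {I J L : Ideal R} {f : R}
    (hJ : ∀ g, g ∈ J ↔ f * g ∈ I) (hL : L = I ⊔ Ideal.span {f}) :
    ∃ S : ShortComplex (ModuleCat.{0} R), S.ShortExact ∧ S.X₁ = ModuleCat.of R (R ⧸ J) ∧
      S.X₂ = ModuleCat.of R (R ⧸ I) ∧ S.X₃ = ModuleCat.of R (R ⧸ L) := by
  have hJ' : J ≤ LinearMap.ker (I.mkQ ∘ₗ LinearMap.lsmul R R f) := fun g hg ↦ by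
    simpa [Ideal.Quotient.eq_zero_iff_mem, ← map_mul] using (hJ g).1 hg
  have hIL : I ≤ L := hL ▸ le_sup_left
  have hfL : f ∈ L := hL ▸ Ideal.mem_sup_right (Ideal.mem_span_singleton_self f)
  let φ : (R ⧸ J) →ₗ[R] (R ⧸ I) := J.liftQ (I.mkQ ∘ₗ LinearMap.lsmul R R f) hJ'
  let ψ : (R ⧸ I) →ₗ[R] (R ⧸ L) := Submodule.factor hIL
  have hφ (g : R) : φ (J.mkQ g) = I.mkQ (f * g) := rfl
  have hψ (g : R) : ψ (I.mkQ g) = L.mkQ g := rfl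
  have hzero : ModuleCat.ofHom φ ≫ ModuleCat.ofHom ψ = 0 := by
    refine ModuleCat.hom_ext (LinearMap.ext fun x ↦ ?_)
    obtain ⟨g, rfl⟩ := J.mkQ_surjective x
    change ψ (φ (J.mkQ g)) = 0
    rw [hφ, hψ]
    exact (Submodule.Quotient.mk_eq_zero L).2 (L.mul_mem_right _ hfL)
  refine ⟨ShortComplex.mk (ModuleCat.ofHom φ) (ModuleCat.ofHom ψ) hzero, ?_, rfl, rfl, rfl⟩
  refine { exact := ?_, mono_f := ?_, epi_g := ?_ }
  · rw [ShortComplex.moduleCat_exact_iff]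
    intro x hx
    obtain ⟨g, rfl⟩ := I.mkQ_surjective x
    have hg : g ∈ I ⊔ Ideal.span {f} := hL ▸ (Submodule.Quotient.mk_eq_zero L).1 hx
    obtain ⟨a, ha, b, hb, rfl⟩ := Submodule.mem_sup.1 hg
    obtain ⟨c, rfl⟩ := Ideal.mem_span_singleton'.1 hb
    refine ⟨J.mkQ c, (Submodule.Quotient.eq I).2 ?_⟩
    convert I.neg_mem ha using 1
    simp only [LinearMap.lsmul_apply, smul_eq_mul]
    ring
  · rw [ModuleCat.mono_iff_injective]
    refine (injective_iff_map_eq_zero φ).2 fun x hx ↦ ?_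
    obtain ⟨g, rfl⟩ := J.mkQ_surjective x
    exact (Submodule.Quotient.mk_eq_zero J).2 ((hJ g).2 ((Submodule.Quotient.mk_eq_zero I).1 hx))
  · rw [ModuleCat.epi_iff_surjective]
    exact Submodule.factor_surjective hIL

/-- The projective dimension of `R ⧸ I` is at most the real number `r`. -/
def QuotientPdLE {R : Type} [CommRing R] (I : Ideal R) (r : ℝ) : Prop :=
  ∀ n : ℕ, r < n → HasProjectiveDimensionLT (ModuleCat.of R (R ⧸ I)) n

namespace QuotientPdLE

variable {R : Type} [CommRing R] {I J L : Ideal R} {f : R} {r s : ℝ}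

lemma mono (h : QuotientPdLE I r) (hrs : r ≤ s) : QuotientPdLE I s :=
  fun n hn ↦ h n (hrs.trans_lt hn)

lemma of_colon (hJ : ∀ g, g ∈ J ↔ f * g ∈ I) (hL : L = I ⊔ Ideal.span {f})
    (h₁ : QuotientPdLE J r) (h₂ : QuotientPdLE L r) : QuotientPdLE I r := by
  obtain ⟨S, hS, e₁, e₂, e₃⟩ := exists_shortExact_quotient_colon hJ hL
  intro n hn
  rw [← e₂]
  exact hS.hasProjectiveDimensionLT_X₂ n (e₁ ▸ h₁ n hn) (e₃ ▸ h₂ n hn)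

lemma sup_span_singleton (hf : ∀ g, f * g ∈ I → g ∈ I) (hr : 0 ≤ r)
    (h : QuotientPdLE I r) : QuotientPdLE (I ⊔ Ideal.span {f}) (r + 1) := by
  obtain ⟨S, hS, e₁, e₂, e₃⟩ := exists_shortExact_quotient_colon (J := I) (f := f)
    (fun g ↦ ⟨fun hg ↦ I.mul_mem_left f hg, hf g⟩) rfl
  rintro (_ | n) hn
  · norm_num at hn
    linarith
  · push_cast at hn
    have hrn : r < n := by linarith
    rw [← e₃]
    refine hS.hasProjectiveDimensionLT_X₃ n (e₁ ▸ h n hrn) (e₂ ▸ h (n + 1) ?_)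
    push_cast
    linarith

lemma bot : QuotientPdLE (⊥ : Ideal R) 0 := by
  intro n hn
  have : Module.Projective R (R ⧸ (⊥ : Ideal R)) :=
    Module.Projective.of_equiv (Submodule.quotEquivOfEqBot (⊥ : Ideal R) rfl).symm
  have hn' : 1 ≤ n := by exact_mod_cast hn
  have := (IsProjective.iff_projective (R := R) (R ⧸ (⊥ : Ideal R))).1 this
  exact hasProjectiveDimensionLT_of_ge _ 1 n hn'

lemma projDim_le (h : QuotientPdLE I r) :
    projDim R (ModuleCat.of R (R ⧸ I)) ≤ (⌊r⌋₊ : ℕ) := by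
  have := h (⌊r⌋₊ + 1) (by exact_mod_cast Nat.lt_floor_add_one r)
  exact projDim_le_of_hasProjectiveDimensionLT _ _

end QuotientPdLE

section Graph

variable {V : Type} (G : SimpleGraph V)

/-- The exponents of the monomials `x_u * x_v`, for `(u, v)` an edge inside `W`, and `x_a`, for
`a` in `A`. -/
def edgeVarExponents (W A : Finset V) : Set (V →₀ ℕ) :=
  {s | (∃ u ∈ W, ∃ v ∈ W, G.Adj u v ∧ s = Finsupp.single u 1 + Finsupp.single v 1) ∨
    ∃ a ∈ A, s = Finsupp.single a 1}

/-- The ideal generated by the edge ideal of the subgraph induced on `W` and the variables in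
`A`. -/
noncomputable def edgeVarIdeal (K : Type) [Field K] (W A : Finset V) :
    Ideal (MvPolynomial V K) :=
  Ideal.span ((fun s ↦ MvPolynomial.monomial s (1 : K)) '' edgeVarExponents G W A)

/-- The monomial with exponent `t` lies in `edgeVarIdeal K G W A`. -/
def EdgeVarDvd (W A : Finset V) (t : V →₀ ℕ) : Prop :=
  (∃ u ∈ W, ∃ v ∈ W, G.Adj u v ∧ t u ≠ 0 ∧ t v ≠ 0) ∨ ∃ a ∈ A, t a ≠ 0

lemma single_one_le_iff {u : V} {t : V →₀ ℕ} : Finsupp.single u 1 ≤ t ↔ t u ≠ 0 := by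
  rw [Finsupp.single_le_iff, Nat.one_le_iff_ne_zero]

lemma exists_mem_edgeVarExponents_le_iff {W A : Finset V} {t : V →₀ ℕ} :
    (∃ s ∈ edgeVarExponents G W A, s ≤ t) ↔ EdgeVarDvd G W A t := by
  have key {u v : V} (h : G.Adj u v) :
      Finsupp.single u 1 + Finsupp.single v 1 ≤ t ↔ t u ≠ 0 ∧ t v ≠ 0 := by
    constructor
    · intro hle
      exact ⟨single_one_le_iff.1 (le_self_add.trans hle),
        single_one_le_iff.1 (le_add_self.trans hle)⟩
    · classical
      rintro ⟨hu, hv⟩ w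
      simp only [Finsupp.add_apply, Finsupp.single_apply]
      have := h.ne
      split_ifs with h₁ h₂ h₂ <;> subst_vars <;> first | contradiction | lia
  constructor
  · rintro ⟨_, ⟨u, hu, v, hv, h, rfl⟩ | ⟨a, ha, rfl⟩, hle⟩
    · exact .inl ⟨u, hu, v, hv, h, (key h).1 hle⟩
    · exact .inr ⟨a, ha, single_one_le_iff.1 hle⟩
  · rintro (⟨u, hu, v, hv, h, ht⟩ | ⟨a, ha, ht⟩)
    · exact ⟨_, .inl ⟨u, hu, v, hv, h, rfl⟩, (key h).2 ht⟩
    · exact ⟨_, .inr ⟨a, ha, rfl⟩, single_one_le_iff.2 ht⟩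

variable {G} {K : Type} [Field K]

lemma mem_edgeVarIdeal {W A : Finset V} {f : MvPolynomial V K} :
    f ∈ edgeVarIdeal G K W A ↔ ∀ t ∈ f.support, EdgeVarDvd G W A t := by
  simp_rw [← exists_mem_edgeVarExponents_le_iff]
  exact MvPolynomial.mem_ideal_span_monomial_image

lemma X_mul_mem_edgeVarIdeal {W A : Finset V} {v : V} {f : MvPolynomial V K} :
    MvPolynomial.X v * f ∈ edgeVarIdeal G K W A ↔
      ∀ t ∈ f.support, EdgeVarDvd G W A (Finsupp.single v 1 + t) := by
  simp [mem_edgeVarIdeal, MvPolynomial.support_X_mul]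

lemma single_add_apply_ne_zero {v u : V} {t : V →₀ ℕ} :
    (Finsupp.single v 1 + t : V →₀ ℕ) u ≠ 0 ↔ v = u ∨ t u ≠ 0 := by
  by_cases h : v = u <;> simp [h]

lemma edgeVarIdeal_eq_of_subset {W W' A : Finset V} (hW : W' ⊆ W)
    (h : ∀ u ∈ W, ∀ v ∈ W, G.Adj u v → u ∈ W' ∧ v ∈ W') :
    edgeVarIdeal G K W A = edgeVarIdeal G K W' A := by
  ext f
  simp only [mem_edgeVarIdeal]
  refine forall₂_congr fun t _ ↦ or_congr_left ⟨?_, ?_⟩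
  · rintro ⟨u, hu, v, hv, ha, ht⟩
    exact ⟨u, (h u hu v hv ha).1, v, (h u hu v hv ha).2, ha, ht⟩
  · rintro ⟨u, hu, v, hv, ha, ht⟩
    exact ⟨u, hW hu, v, hW hv, ha, ht⟩

lemma mem_edgeVarIdeal_of_X_mul_mem {W A : Finset V} {v : V} (hW : v ∉ W) (hA : v ∉ A)
    {f : MvPolynomial V K} (h : MvPolynomial.X v * f ∈ edgeVarIdeal G K W A) :
    f ∈ edgeVarIdeal G K W A := by
  rw [X_mul_mem_edgeVarIdeal] at h
  rw [mem_edgeVarIdeal]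
  intro t ht
  have := h t ht
  simp only [EdgeVarDvd, single_add_apply_ne_zero] at this ⊢
  grind

lemma edgeIdeal_eq_edgeVarIdeal [Fintype V] : edgeIdeal K G = edgeVarIdeal G K Finset.univ ∅ := by
  have : {p : MvPolynomial V K | ∃ u v, G.Adj u v ∧ p = MvPolynomial.X u * MvPolynomial.X v} =
      (fun s ↦ MvPolynomial.monomial s (1 : K)) '' edgeVarExponents G Finset.univ ∅ := by
    ext p
    simp only [edgeVarExponents, MvPolynomial.X, MvPolynomial.monomial_mul, Set.mem_image,
      Set.mem_ofPred_eq, Finset.mem_univ, true_and, Finset.notMem_empty, false_and, exists_false,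
      or_false, mul_one]
    constructor
    · rintro ⟨u, v, h, rfl⟩
      exact ⟨_, ⟨u, v, h, rfl⟩, rfl⟩
    · rintro ⟨_, ⟨u, v, h, rfl⟩, rfl⟩
      exact ⟨u, v, h, rfl⟩
  rw [edgeIdeal, edgeVarIdeal, this]

variable [DecidableEq V]

lemma edgeVarIdeal_erase_insert (W A : Finset V) (v : V) :
    edgeVarIdeal G K (W.erase v) (insert v A) =
      edgeVarIdeal G K W A ⊔ Ideal.span {MvPolynomial.X v} := by
  have : ({MvPolynomial.X v} : Set (MvPolynomial V K)) =
      (fun s ↦ MvPolynomial.monomial s (1 : K)) '' {Finsupp.single v 1} := by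
    simp [MvPolynomial.X]
  rw [this, edgeVarIdeal, edgeVarIdeal, ← Ideal.span_union, ← Set.image_union]
  ext f
  rw [← edgeVarIdeal, mem_edgeVarIdeal, MvPolynomial.mem_ideal_span_monomial_image]
  refine forall₂_congr fun t _ ↦ ?_
  simp only [Set.mem_union, Set.mem_singleton_iff, or_and_right, exists_or, exists_eq_left,
    exists_mem_edgeVarExponents_le_iff, single_one_le_iff]
  simp only [EdgeVarDvd, Finset.mem_erase, Finset.mem_insert]
  grind

lemma mem_edgeVarIdeal_iff_X_mul_mem [DecidableRel G.Adj] {W A : Finset V} {v : V} (hW : v ∈ W)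
    (hA : v ∉ A) (f : MvPolynomial V K) :
    f ∈ edgeVarIdeal G K (W.filter fun w ↦ w ≠ v ∧ ¬ G.Adj v w) (A ∪ W.filter (G.Adj v)) ↔
      MvPolynomial.X v * f ∈ edgeVarIdeal G K W A := by
  rw [X_mul_mem_edgeVarIdeal, mem_edgeVarIdeal]
  refine forall₂_congr fun t _ ↦ ?_
  simp only [EdgeVarDvd, single_add_apply_ne_zero, Finset.mem_filter, Finset.mem_union]
  constructor
  · rintro (⟨u, hu, w, hw, h, ht⟩ | ⟨a, ha | ha, ht⟩)
    · exact .inl ⟨u, hu.1, w, hw.1, h, .inr ht.1, .inr ht.2⟩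
    · exact .inr ⟨a, ha, .inr ht⟩
    · exact .inl ⟨v, hW, a, ha.1, ha.2, .inl rfl, .inr ht⟩
  · have := G.adj_comm
    have := G.irrefl (v := v)
    grind

lemma quotientPdLE_edgeVarIdeal_empty (A : Finset V) :
    QuotientPdLE (edgeVarIdeal G K ∅ A) A.card := by
  induction A using Finset.induction_on with
  | empty =>
    have : edgeVarIdeal G K ∅ ∅ = ⊥ := by simp [edgeVarIdeal, edgeVarExponents]
    simpa [this] using QuotientPdLE.bot
  | insert v A hv ih =>
    have h := edgeVarIdeal_erase_insert (G := G) (K := K) ∅ A v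
    rw [Finset.erase_empty] at h
    rw [h, Finset.card_insert_of_notMem hv, Nat.cast_succ]
    exact ih.sup_span_singleton
      (fun _ ↦ mem_edgeVarIdeal_of_X_mul_mem (Finset.notMem_empty v) hv) (Nat.cast_nonneg _)

lemma add_mul_one_sub_le {D a a' w w' t : ℝ} (hD : 0 < D) (ht : t ≤ D) (ha : a' + 1 ≤ a + t)
    (hw : w' + t ≤ w) (hD' : 1 ≤ D) : a' + w' * (1 - 1 / D) ≤ a + w * (1 - 1 / D) := by
  have h₁ : 0 ≤ 1 - 1 / D := by
    rw [sub_nonneg, div_le_one hD]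
    exact hD'
  have h₂ : t * (1 / D) ≤ 1 := by
    rw [mul_one_div, div_le_one hD]
    exact ht
  nlinarith [mul_le_mul_of_nonneg_right hw h₁]

variable [Fintype V] [DecidableRel G.Adj]

/-- If every nonempty set `U` of vertices contains one with at most `α * |U|` non-neighbours in
`U`, then the edge ideal satisfies the bound given by any `D` with
`deg u + α * deg v + 1 ≤ D` on all edges. -/
lemma quotientPdLE_edgeVarIdeal {α D : ℝ} (hα : 0 ≤ α) (hD₁ : 1 ≤ D)
    (hD : ∀ u v, G.Adj u v → (G.degree u : ℝ) + α * G.degree v + 1 ≤ D)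
    (hU : ∀ U : Finset V, U.Nonempty →
      ∃ z ∈ U, ((U.filter fun w ↦ w ≠ z ∧ ¬ G.Adj z w).card : ℝ) ≤ α * U.card)
    (W A : Finset V) (hWA : Disjoint W A) :
    QuotientPdLE (edgeVarIdeal G K W A) (A.card + W.card * (1 - 1 / D)) := by
  have hD₀ : 0 < D := by linarith
  induction W using Finset.strongInduction generalizing A with
  | H W ih =>
  by_cases hedge : ∃ y ∈ W, ∃ x ∈ W, G.Adj y x
  · obtain ⟨y, hy, x, hx, hyx⟩ := hedge
    set B := W.filter (G.Adj y) with hB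
    have hBdeg : B.card ≤ G.degree y := by
      rw [← G.card_neighborFinset_eq_degree]
      exact Finset.card_le_card fun w hw ↦ by simpa using (Finset.mem_filter.1 hw).2
    have step (T : Finset V) (z : V) (hT : insert z T ⊆ B) (hz : z ∉ T)
        (hcard : ((T.filter fun w ↦ ¬ G.Adj z w).card : ℝ) ≤ α * B.card)
        (h : QuotientPdLE (edgeVarIdeal G K (W \ insert z T) (A ∪ insert z T))
          (A.card + W.card * (1 - 1 / D))) :
        QuotientPdLE (edgeVarIdeal G K (W \ T) (A ∪ T)) (A.card + W.card * (1 - 1 / D)) := by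
      have hzB : z ∈ B := hT (Finset.mem_insert_self z T)
      have hzW : z ∈ W := (Finset.mem_filter.1 hzB).1
      have hzy : G.Adj z y := (Finset.mem_filter.1 hzB).2.symm
      have hTW : T ⊆ W := (Finset.subset_insert z T).trans (hT.trans (Finset.filter_subset _ _))
      have hzA : z ∉ A := Finset.disjoint_left.1 hWA hzW
      have hzWT : z ∈ W \ T := Finset.mem_sdiff.2 ⟨hzW, hz⟩
      refine QuotientPdLE.of_colon (f := MvPolynomial.X z)
        (mem_edgeVarIdeal_iff_X_mul_mem hzWT (by simp [hzA, hz]))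
        (edgeVarIdeal_erase_insert _ _ z) ?_ ?_
      · refine (ih _ ?_ _ ?_).mono ?_
        · exact Finset.ssubset_iff_subset_ne.2
            ⟨(Finset.filter_subset _ _).trans Finset.sdiff_subset, fun he ↦ by
              have := he ▸ hzW
              simp at this⟩
        · rw [Finset.disjoint_left] at hWA ⊢
          grind
        · set N := (W \ T).filter (G.Adj z) with hN
          set W' := (W \ T).filter fun w ↦ w ≠ z ∧ ¬ G.Adj z w with hW'
          have h₁ : (N.card : ℝ) + T.card + 1 ≤ D := by
            have hsub : N ∪ T.filter (G.Adj z) ⊆ G.neighborFinset z := by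
              intro w hw
              simp only [hN, Finset.mem_union, Finset.mem_filter] at hw
              simp only [SimpleGraph.mem_neighborFinset]
              tauto
            have hdisj : Disjoint N (T.filter (G.Adj z)) := by
              rw [Finset.disjoint_left]
              grind
            have hle := Finset.card_le_card hsub
            rw [Finset.card_union_of_disjoint hdisj, G.card_neighborFinset_eq_degree] at hle
            have hsplit := Finset.card_filter_add_card_filter_not (s := T) (G.Adj z)
            have hmul : α * B.card ≤ α * G.degree y :=
              mul_le_mul_of_nonneg_left (by exact_mod_cast hBdeg) hα
            have := hD z y hzy
            have hle' : (N.card : ℝ) + (T.filter (G.Adj z)).card ≤ G.degree z := by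
              exact_mod_cast hle
            have hsplit' : ((T.filter (G.Adj z)).card : ℝ) + (T.filter fun w ↦ ¬ G.Adj z w).card
                = T.card := by exact_mod_cast hsplit
            linarith
          have h₂ : (A ∪ T ∪ N).card ≤ A.card + T.card + N.card :=
            (Finset.card_union_le _ _).trans (Nat.add_le_add_right (Finset.card_union_le _ _) _)
          have h₃ : W'.card + (N.card + T.card + 1) = W.card := by
            have e₁ : W' ∪ N = (W \ T).erase z := by
              have := G.irrefl (v := z)
              ext w
              grind
            have e₂ : Disjoint W' N := by
              rw [Finset.disjoint_left]
              grind
            have e₃ := Finset.card_union_of_disjoint e₂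
            rw [e₁, Finset.card_erase_of_mem hzWT] at e₃
            have e₄ := Finset.card_sdiff_add_card_eq_card hTW
            have e₅ := Finset.card_pos.2 ⟨z, hzWT⟩
            lia
          refine add_mul_one_sub_le hD₀ h₁ ?_ ?_ hD₁
          · have : ((A ∪ T ∪ N).card : ℝ) ≤ A.card + T.card + N.card := by exact_mod_cast h₂
            linarith
          · exact le_of_eq (by exact_mod_cast h₃)
      · have e₁ : (W \ T).erase z = W \ insert z T := by ext w; grind
        have e₂ : insert z (A ∪ T) = A ∪ insert z T := by ext w; grind
        rwa [e₁, e₂]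
    have descend (U : Finset V) (hUB : U ⊆ B)
        (h : QuotientPdLE (edgeVarIdeal G K (W \ U) (A ∪ U)) (A.card + W.card * (1 - 1 / D))) :
        QuotientPdLE (edgeVarIdeal G K W A) (A.card + W.card * (1 - 1 / D)) := by
      induction U using Finset.strongInduction with
      | H U ihU =>
      obtain rfl | hne := U.eq_empty_or_nonempty
      · simpa using h
      · obtain ⟨z, hz, hcard⟩ := hU U hne
        refine ihU (U.erase z) (Finset.erase_ssubset hz) ((Finset.erase_subset _ _).trans hUB)
          (step (U.erase z) z ?_ (Finset.notMem_erase z U) ?_ ?_)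
        · rwa [Finset.insert_erase hz]
        · have e : ((U.erase z).filter fun w ↦ ¬ G.Adj z w) =
              U.filter fun w ↦ w ≠ z ∧ ¬ G.Adj z w := by ext w; grind
          rw [e]
          exact hcard.trans (mul_le_mul_of_nonneg_left
            (by exact_mod_cast Finset.card_le_card hUB) hα)
        · rwa [Finset.insert_erase hz]
    refine descend B subset_rfl ?_
    have hyB : y ∉ B := by simp [hB]
    have hyWB : y ∈ W \ B := Finset.mem_sdiff.2 ⟨hy, hyB⟩
    rw [edgeVarIdeal_eq_of_subset (W' := (W \ B).erase y) (Finset.erase_subset _ _)]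
    · refine (ih _ ?_ _ ?_).mono ?_
      · exact Finset.ssubset_of_ssubset_of_subset (Finset.erase_ssubset hyWB) Finset.sdiff_subset
      · rw [Finset.disjoint_left] at hWA ⊢
        grind
      · refine add_mul_one_sub_le (t := B.card + 1) hD₀ ?_ ?_ ?_ hD₁
        · have := hD y x hyx
          have : (B.card : ℝ) ≤ G.degree y := by exact_mod_cast hBdeg
          have : 0 ≤ α * G.degree x := mul_nonneg hα (Nat.cast_nonneg _)
          linarith
        · have : ((A ∪ B).card : ℝ) ≤ A.card + B.card := by
            exact_mod_cast Finset.card_union_le A B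
          linarith
        · have e₁ := Finset.card_erase_add_one hyWB
          have e₂ := Finset.card_sdiff_add_card_eq_card (Finset.filter_subset (G.Adj y) W)
          have : ((W \ B).erase y).card + (B.card + 1) = W.card := by lia
          exact le_of_eq (by exact_mod_cast this)
    · have hy_adj {u v : V} (hu : u ∈ W \ B) (huv : G.Adj u v) : v ≠ y := by
        rintro rfl
        rw [Finset.mem_sdiff, hB, Finset.mem_filter] at hu
        exact hu.2 ⟨hu.1, huv.symm⟩
      exact fun u hu v hv huv ↦ ⟨Finset.mem_erase.2 ⟨hy_adj hv huv.symm, hu⟩,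
        Finset.mem_erase.2 ⟨hy_adj hu huv, hv⟩⟩
  · rw [edgeVarIdeal_eq_of_subset (W' := ∅) (Finset.empty_subset _)]
    · refine (quotientPdLE_edgeVarIdeal_empty A).mono (le_add_of_nonneg_right ?_)
      refine mul_nonneg (Nat.cast_nonneg _) ?_
      rw [sub_nonneg, div_le_one hD₀]
      exact hD₁
    · exact fun u hu v hv h ↦ (hedge ⟨u, hu, v, hv, h⟩).elim

/-- In a graph without independent sets of size `m + 1`, every nonempty set `U` of vertices
contains a vertex with at most `((m - 1) / m) * |U|` non-neighbours in `U`. -/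
lemma exists_card_nonneighbors_le {m : ℕ} (hm : 1 ≤ m)
    (hind : ¬ ∃ A : Set V, IsIndepSet G A ∧ A.ncard = m + 1) (U : Finset V) (hU : U.Nonempty) :
    ∃ z ∈ U, ((U.filter fun w ↦ w ≠ z ∧ ¬ G.Adj z w).card : ℝ) ≤ ((m : ℝ) - 1) / m * U.card := by
  have hm₀ : (0 : ℝ) < m := by exact_mod_cast hm
  classical
  obtain ⟨I, hI, hmax⟩ := (U.powerset.filter fun I : Finset V ↦ IsIndepSet G I).exists_max_image
    Finset.card ⟨∅, by simp [IsIndepSet]⟩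
  simp only [Finset.mem_filter, Finset.mem_powerset] at hI hmax
  obtain ⟨hIU, hI⟩ := hI
  have hIm : I.card ≤ m := by
    by_contra! hlt
    obtain ⟨J, hJI, hJ⟩ := Finset.exists_subset_card_eq hlt
    exact hind ⟨J, fun u hu v hv ↦ hI u (hJI hu) v (hJI hv), by simpa using hJ⟩
  have hcover : U ⊆ I.biUnion fun z ↦ U.filter fun w ↦ w = z ∨ G.Adj z w := by
    intro w hw
    by_contra hcon
    have hcon' : ∀ z ∈ I, w ≠ z ∧ ¬ G.Adj z w := by simpa [hw] using hcon
    have hwI : w ∉ I := fun h ↦ (hcon' w h).1 rfl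
    have := hmax (insert w I) ⟨Finset.insert_subset hw hIU, by
      have := G.adj_comm
      have := G.irrefl (v := w)
      simp only [IsIndepSet, Finset.coe_insert, Set.mem_insert_iff, Finset.mem_coe] at hI ⊢
      grind⟩
    rw [Finset.card_insert_of_notMem hwI] at this
    lia
  obtain ⟨z, hz, hle⟩ : ∃ z ∈ I,
      U.card ≤ m * (U.filter fun w ↦ w = z ∨ G.Adj z w).card := by
    by_contra! hcon
    have hIne : I.Nonempty := by
      obtain ⟨w, hw⟩ := hU
      obtain ⟨z, hz, -⟩ := Finset.mem_biUnion.1 (hcover hw)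
      exact ⟨z, hz⟩
    have h₁ := (Finset.card_le_card hcover).trans Finset.card_biUnion_le
    have h₂ := Finset.sum_lt_sum_of_nonempty hIne hcon
    rw [← Finset.mul_sum, Finset.sum_const, smul_eq_mul] at h₂
    have h₃ := Nat.mul_le_mul_left m h₁
    have h₄ := Nat.mul_le_mul_right U.card hIm
    lia
  refine ⟨z, hIU hz, ?_⟩
  have hsplit := Finset.card_filter_add_card_filter_not (s := U) (fun w ↦ w = z ∨ G.Adj z w)
  simp only [not_or] at hsplit
  rw [div_mul_eq_mul_div, le_div_iff₀ hm₀]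
  have hle' : (U.card : ℝ) ≤ m * (U.filter fun w ↦ w = z ∨ G.Adj z w).card := by
    exact_mod_cast hle
  have hsplit' : ((U.filter fun w ↦ w = z ∨ G.Adj z w).card : ℝ) +
      (U.filter fun w ↦ w ≠ z ∧ ¬ G.Adj z w).card = U.card := by exact_mod_cast hsplit
  nlinarith

end Graph

theorem stmt6 (K : Type) [Field K] {V : Type} [Fintype V] (G : SimpleGraph V)
    (m : ℕ) (hm : 1 ≤ m)
    (hind : ¬ ∃ A : Set V, IsIndepSet G A ∧ A.ncard = m + 1)
    (x y : V) (hmax : IsAlphaMaxEdge G (((m : ℝ) - 1) / m) x y)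
    (hde : (G.neighborSet y).ncard ≤ (G.neighborSet x).ncard) :
    ((graphPd K G : ℝ≥0∞) : EReal) ≤
      (((Fintype.card V : ℝ) *
        (1 - 1 / (((G.neighborSet x).ncard : ℝ)
          + ((m : ℝ) - 1) / m * ((G.neighborSet y).ncard : ℝ) + 1))) : EReal) := by
  classical
  have hncard (v : V) : (G.neighborSet v).ncard = G.degree v := by
    rw [Set.ncard_eq_toFinset_card', ← G.card_neighborFinset_eq_degree]
    rfl
  have hm₁ : (1 : ℝ) ≤ m := by exact_mod_cast hm
  have hα : 0 ≤ ((m : ℝ) - 1) / m := div_nonneg (by linarith) (by linarith)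
  obtain ⟨-, hmax⟩ := hmax
  simp only [hncard] at hmax ⊢
  set D : ℝ := (G.degree x : ℝ) + ((m : ℝ) - 1) / m * G.degree y + 1 with hD
  have hD₁ : 1 ≤ D := by
    have : 0 ≤ (G.degree x : ℝ) + ((m : ℝ) - 1) / m * G.degree y := by positivity
    linarith
  have h : QuotientPdLE (edgeIdeal K G) ((Fintype.card V : ℝ) * (1 - 1 / D)) := by
    rw [edgeIdeal_eq_edgeVarIdeal]
    simpa using quotientPdLE_edgeVarIdeal (K := K) hα hD₁
      (fun u v huv ↦ add_le_add_left (hmax u v huv) 1) (exists_card_nonneighbors_le hm hind)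
      Finset.univ ∅ (Finset.disjoint_empty_right _)
  have hr : 0 ≤ (Fintype.card V : ℝ) * (1 - 1 / D) := by
    refine mul_nonneg (Nat.cast_nonneg _) ?_
    rw [sub_nonneg, div_le_one (by linarith)]
    exact hD₁
  have hpd : ((graphPd K G : ℝ≥0∞) : EReal) ≤
      (((⌊(Fintype.card V : ℝ) * (1 - 1 / D)⌋₊ : ℕ∞) : ℝ≥0∞) : EReal) :=
    EReal.coe_ennreal_le_coe_ennreal_iff.2 (ENat.toENNReal_le.2 h.projDim_le)
  refine hpd.trans ?_
  have hfloor := Nat.floor_le hr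
  have hcast (k : ℕ) : (((k : ℕ∞) : ℝ≥0∞) : EReal) = ((k : ℝ) : EReal) := by
    rw [ENat.toENNReal_coe]
    rfl
  rw [hcast]
  refine (EReal.coe_le_coe_iff.2 hfloor).trans_eq ?_
  rw [hD, ← EReal.coe_coe_eq_natCast m]
  rfl
end
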